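/- Let n ≥ 2, let r₁, …, r_n ∈ ℕ, and set r = n (Σ_{k=1}^n 1/r_k)^{−1}. Then there is a constant c (depending only on n, r₁, …, r_n) such that for every f ∈ W₁^{r₁,…,r_n}(ℝⁿ), ∫_{ℝⁿ} |f̂(ξ)| (Σ_{k=1}^n |ξ_k|^{r_k})^{1 − n/r} dξ ≤ c Σ_{k=1}^n ‖D_k^{r_k} f‖₁. -/

import Mathlib

open MeasureTheory Set ENNReal

/-- The Fourier transform (as an integral) `f̂(ξ) = ∫ f(x) e^{-2πi x·ξ} dx`. -/
noncomputable def fourierTf {n : ℕ} (f : EuclideanSpace ℝ (Fin n) → ℂ)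
    (ξ : EuclideanSpace ℝ (Fin n)) : ℂ :=
  ∫ x, Complex.exp (((-(2 * Real.pi * (@inner ℝ _ _ x ξ)) : ℝ) : ℂ) * Complex.I) * f x

/-- The partial derivative `∂_k φ (x) = Dφ(x)[e_k]`. -/
noncomputable def pderiv {n : ℕ} (k : Fin n)
    (φ : EuclideanSpace ℝ (Fin n) → ℝ) : EuclideanSpace ℝ (Fin n) → ℝ :=
  fun x => fderiv ℝ φ x (EuclideanSpace.single k (1 : ℝ))

section

variable {n : ℕ}

/-- `Sφ(x) = ∫₀ʰ φ(x - t v) dt`. -/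
noncomputable def backAvg {n : ℕ} (v : EuclideanSpace ℝ (Fin n)) (h : ℝ)
    (φ : EuclideanSpace ℝ (Fin n) → ℝ) : EuclideanSpace ℝ (Fin n) → ℝ :=
  fun x => ∫ t in Ioc 0 h, φ (x - t • v)

/-- `TG(x) = ∫₀ʰ G(x + t v) dt`. -/
noncomputable def fwdAvg {n : ℕ} (v : EuclideanSpace ℝ (Fin n)) (h : ℝ)
    (G : EuclideanSpace ℝ (Fin n) → ℝ) : EuclideanSpace ℝ (Fin n) → ℝ :=
  fun x => ∫ t in Ioc 0 h, G (x + t • v)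

/-- `G` is the `m`-th weak derivative of `F` in direction `k`. -/
def IsWeakDeriv {n : ℕ} (k : Fin n) (m : ℕ) (F G : EuclideanSpace ℝ (Fin n) → ℝ) : Prop :=
  ∀ φ : EuclideanSpace ℝ (Fin n) → ℝ, ContDiff ℝ (⊤ : ℕ∞) φ → HasCompactSupport φ →
    ∫ x, F x * ((pderiv k)^[m] φ) x = (-1 : ℝ) ^ m * ∫ x, G x * φ x

lemma contDiff_backAvg (v : EuclideanSpace ℝ (Fin n)) (h : ℝ)
    {φ : EuclideanSpace ℝ (Fin n) → ℝ} (hφ : ContDiff ℝ (⊤ : ℕ∞) φ) (hc : HasCompactSupport φ) :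
    ContDiff ℝ (⊤ : ℕ∞) (backAvg v h φ) := by
  have hm : Measurable fun t : ℝ => t • v := by fun_prop
  set μ : Measure (EuclideanSpace ℝ (Fin n)) :=
    (volume.restrict (Ioc (0 : ℝ) h)).map fun t => t • v with hμ
  have hfin : IsFiniteMeasure μ := by
    rw [hμ]; exact Measure.isFiniteMeasure_map _ _
  have key : backAvg v h φ =
      convolution (fun _ : EuclideanSpace ℝ (Fin n) => (1 : ℝ)) φ
        (ContinuousLinearMap.mul ℝ ℝ) μ := by
    funext x
    simp only [convolution, backAvg, ContinuousLinearMap.mul_apply', one_mul, hμ]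
    rw [integral_map hm.aemeasurable]
    exact (by have := hφ.continuous; fun_prop : Continuous fun t => φ (x - t)).aestronglyMeasurable
  rw [key]
  exact hc.contDiff_convolution_right _ (locallyIntegrable_const _) hφ

lemma hasCompactSupport_backAvg (v : EuclideanSpace ℝ (Fin n)) (h : ℝ)
    {φ : EuclideanSpace ℝ (Fin n) → ℝ} (hc : HasCompactSupport φ) :
    HasCompactSupport (backAvg v h φ) := by
  have hK : IsCompact ((fun p : EuclideanSpace ℝ (Fin n) × ℝ => p.1 + p.2 • v) ''
      (tsupport φ ×ˢ Icc 0 h)) :=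
    (hc.isCompact.prod isCompact_Icc).image (by fun_prop)
  refine HasCompactSupport.intro hK fun x hx => ?_
  refine setIntegral_eq_zero_of_forall_eq_zero fun t ht => ?_
  by_contra hne
  exact hx ⟨(x - t • v, t), ⟨subset_tsupport _ hne, Ioc_subset_Icc_self ht⟩, by simp⟩

lemma pderiv_backAvg (k : Fin n) {h : ℝ} (hh : 0 ≤ h)
    {φ : EuclideanSpace ℝ (Fin n) → ℝ} (hφ : ContDiff ℝ (⊤ : ℕ∞) φ) (hc : HasCompactSupport φ)
    (x : EuclideanSpace ℝ (Fin n)) :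
    pderiv k (backAvg (EuclideanSpace.single k 1) h φ) x =
      φ x - φ (x - h • EuclideanSpace.single k 1) := by
  set e : EuclideanSpace ℝ (Fin n) := EuclideanSpace.single k 1
  have hd : DifferentiableAt ℝ (backAvg e h φ) x :=
    (contDiff_backAvg e h hφ hc).differentiable (by simp) x
  have h1 : HasDerivAt (fun s : ℝ => backAvg e h φ (x + s • e)) (pderiv k (backAvg e h φ) x) 0 :=
    hd.hasFDerivAt.hasLineDerivAt e
  have hcont : Continuous fun u : ℝ => φ (x + u • e) := by
    have := hφ.continuous; fun_prop
  have h2 : (fun s : ℝ => backAvg e h φ (x + s • e)) =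
      fun s => (∫ u in (0 : ℝ)..s, φ (x + u • e)) - ∫ u in (0 : ℝ)..(s - h), φ (x + u • e) := by
    funext s
    rw [intervalIntegral.integral_interval_sub_left (hcont.intervalIntegrable _ _)
      (hcont.intervalIntegrable _ _)]
    simp only [backAvg]
    rw [← intervalIntegral.integral_of_le hh]
    have := intervalIntegral.integral_comp_sub_left (a := 0) (b := h)
      (fun u : ℝ => φ (x + u • e)) s
    rw [sub_zero] at this
    rw [← this]
    refine intervalIntegral.integral_congr fun t _ => ?_
    simp only [sub_smul]
    congr 1; abel
  have h3 : HasDerivAt (fun s : ℝ => backAvg e h φ (x + s • e))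
      (φ (x + (0 : ℝ) • e) - φ (x + (0 - h) • e)) 0 := by
    rw [h2]
    have a1 := hcont.integral_hasStrictDerivAt 0 (0 : ℝ) |>.hasDerivAt
    have a2 := hcont.integral_hasStrictDerivAt 0 (0 - h : ℝ) |>.hasDerivAt
    exact a1.sub (a2.comp_sub_const 0 h)
  rw [h1.unique h3]
  simp [sub_eq_add_neg]

lemma contDiff_pderiv (k : Fin n) {φ : EuclideanSpace ℝ (Fin n) → ℝ}
    (hφ : ContDiff ℝ (⊤ : ℕ∞) φ) : ContDiff ℝ (⊤ : ℕ∞) (pderiv k φ) :=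
  (hφ.fderiv_right (m := (⊤ : ℕ∞)) (by simp)).clm_apply contDiff_const

lemma hasCompactSupport_pderiv (k : Fin n) {φ : EuclideanSpace ℝ (Fin n) → ℝ}
    (hc : HasCompactSupport φ) : HasCompactSupport (pderiv k φ) :=
  hc.fderiv_apply ℝ _

lemma contDiff_pderiv_iter (k : Fin n) (m : ℕ) {φ : EuclideanSpace ℝ (Fin n) → ℝ}
    (hφ : ContDiff ℝ (⊤ : ℕ∞) φ) : ContDiff ℝ (⊤ : ℕ∞) ((pderiv k)^[m] φ) := by
  induction m generalizing φ with
  | zero => exact hφ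
  | succ m ih => exact ih (contDiff_pderiv k hφ)

lemma hasCompactSupport_pderiv_iter (k : Fin n) (m : ℕ) {φ : EuclideanSpace ℝ (Fin n) → ℝ}
    (hc : HasCompactSupport φ) : HasCompactSupport ((pderiv k)^[m] φ) := by
  induction m generalizing φ with
  | zero => exact hc
  | succ m ih => exact ih (hasCompactSupport_pderiv k hc)

lemma pderiv_sub_shift (k : Fin n) (v : EuclideanSpace ℝ (Fin n))
    {φ : EuclideanSpace ℝ (Fin n) → ℝ} (hφ : ContDiff ℝ (⊤ : ℕ∞) φ) :
    pderiv k (fun x => φ x - φ (x - v)) = fun x => pderiv k φ x - pderiv k φ (x - v) := by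
  funext x
  have hd : Differentiable ℝ φ := hφ.differentiable (by simp)
  simp only [pderiv]
  have h2 : DifferentiableAt ℝ (fun x => φ (x - v)) x :=
    (hd.comp (differentiable_id.sub_const v)) x
  rw [fderiv_fun_sub (hd x) h2, fderiv_comp_sub]
  rfl

lemma pderiv_iter_sub_shift (k : Fin n) (m : ℕ) (v : EuclideanSpace ℝ (Fin n))
    {φ : EuclideanSpace ℝ (Fin n) → ℝ} (hφ : ContDiff ℝ (⊤ : ℕ∞) φ) :
    (pderiv k)^[m] (fun x => φ x - φ (x - v)) =
      fun x => (pderiv k)^[m] φ x - (pderiv k)^[m] φ (x - v) := by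
  induction m generalizing φ with
  | zero => rfl
  | succ m ih =>
    rw [Function.iterate_succ_apply, pderiv_sub_shift k v hφ, ih (contDiff_pderiv k hφ)]
    rfl

lemma measurable_fwdAvg (v : EuclideanSpace ℝ (Fin n)) (h : ℝ)
    {G : EuclideanSpace ℝ (Fin n) → ℝ} (hG : Measurable G) : Measurable (fwdAvg v h G) := by
  have : StronglyMeasurable
      (fun p : EuclideanSpace ℝ (Fin n) × ℝ => G (p.1 + p.2 • v)) :=
    (hG.comp (by fun_prop)).stronglyMeasurable
  exact this.integral_prod_right.measurable

lemma integrable_prod_shift (v : EuclideanSpace ℝ (Fin n)) (h : ℝ)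
    {G : EuclideanSpace ℝ (Fin n) → ℝ} (hG : Measurable G) (hi : Integrable G) :
    Integrable (fun p : EuclideanSpace ℝ (Fin n) × ℝ => G (p.1 + p.2 • v))
      (volume.prod (volume.restrict (Ioc 0 h))) := by
  have hm : Measurable (fun p : EuclideanSpace ℝ (Fin n) × ℝ => G (p.1 + p.2 • v)) :=
    hG.comp (by fun_prop)
  rw [integrable_prod_iff' hm.aestronglyMeasurable]
  refine ⟨Filter.Eventually.of_forall fun t => hi.comp_add_right (t • v), ?_⟩
  have : ∀ t : ℝ, ∫ x, ‖G (x + t • v)‖ = ∫ x, ‖G x‖ := fun t =>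
    integral_add_right_eq_self (fun x => ‖G x‖) (t • v)
  simp only [this]
  exact integrable_const _

lemma integrable_fwdAvg (v : EuclideanSpace ℝ (Fin n)) (h : ℝ)
    {G : EuclideanSpace ℝ (Fin n) → ℝ} (hG : Measurable G) (hi : Integrable G) :
    Integrable (fwdAvg v h G) :=
  (integrable_prod_shift v h hG hi).integral_prod_left

lemma integral_fwdAvg_mul (v : EuclideanSpace ℝ (Fin n)) (h : ℝ)
    {G φ : EuclideanSpace ℝ (Fin n) → ℝ} (hG : Measurable G) (hi : Integrable G)
    (hφ : Continuous φ) (hc : HasCompactSupport φ) :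
    ∫ x, fwdAvg v h G x * φ x = ∫ x, G x * backAvg v h φ x := by
  obtain ⟨C, hC⟩ := hc.exists_bound_of_continuous hφ
  have i1 : Integrable (fun p : EuclideanSpace ℝ (Fin n) × ℝ => G (p.1 + p.2 • v) * φ p.1)
      (volume.prod (volume.restrict (Ioc 0 h))) :=
    (integrable_prod_shift v h hG hi).mul_bdd (c := C)
      (hφ.comp continuous_fst).aestronglyMeasurable
      (Filter.Eventually.of_forall fun p => hC p.1)
  have i2 : Integrable (fun p : EuclideanSpace ℝ (Fin n) × ℝ => G p.1 * φ (p.1 - p.2 • v))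
      (volume.prod (volume.restrict (Ioc 0 h))) := by
    refine Integrable.mul_bdd (c := C) ?_
      (by fun_prop : Continuous fun p : EuclideanSpace ℝ (Fin n) × ℝ =>
        φ (p.1 - p.2 • v)).aestronglyMeasurable (Filter.Eventually.of_forall fun p => hC _)
    simpa using hi.comp_fst (volume.restrict (Ioc 0 h))
  simp only [fwdAvg, backAvg, ← integral_mul_const, ← integral_const_mul]
  rw [integral_integral_swap i1]
  rw [integral_integral_swap (f := fun x t => G x * φ (x - t • v)) i2]
  congr 1
  funext t
  have := integral_add_right_eq_self (μ := volume) (fun x => G x * φ (x - t • v)) (t • v)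
  simpa using this

lemma integral_fwdDiff_mul (v : EuclideanSpace ℝ (Fin n))
    {F φ : EuclideanSpace ℝ (Fin n) → ℝ} (hi : Integrable F)
    (hφ : Continuous φ) (hc : HasCompactSupport φ) :
    ∫ x, fwdDiff v F x * φ x = - ∫ x, F x * (φ x - φ (x - v)) := by
  obtain ⟨C, hC⟩ := hc.exists_bound_of_continuous hφ
  have hb (G : EuclideanSpace ℝ (Fin n) → ℝ) (hG : Integrable G) (w : EuclideanSpace ℝ (Fin n)) :
      Integrable fun x => G x * φ (x - w) :=
    hG.mul_bdd (c := C) (by fun_prop : Continuous fun x => φ (x - w)).aestronglyMeasurable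
      (Filter.Eventually.of_forall fun p => hC _)
  have hF' : Integrable fun x => F (x + v) := hi.comp_add_right v
  have h0 (G : EuclideanSpace ℝ (Fin n) → ℝ) (hG : Integrable G) :
      Integrable fun x => G x * φ x := by simpa using hb G hG 0
  simp only [fwdDiff, sub_mul, mul_sub]
  rw [integral_sub (h0 _ hF') (h0 _ hi), integral_sub (h0 _ hi) (hb _ hi v)]
  have := integral_add_right_eq_self (μ := volume) (fun x => F x * φ (x - v)) v
  simp only [add_sub_cancel_right] at this
  rw [this]; ring

lemma IsWeakDeriv.fwdDiff {k : Fin n} {m : ℕ} {F G : EuclideanSpace ℝ (Fin n) → ℝ}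
    (hw : IsWeakDeriv k (m + 1) F G) (hF : Integrable F) (hG : Measurable G) (hi : Integrable G)
    {h : ℝ} (hh : 0 ≤ h) :
    IsWeakDeriv k m (fwdDiff (h • EuclideanSpace.single k 1) F)
      (fwdAvg (EuclideanSpace.single k 1) h G) := by
  intro φ hφ hc
  rw [integral_fwdDiff_mul _ hF (contDiff_pderiv_iter k m hφ).continuous
    (hasCompactSupport_pderiv_iter k m hc), integral_fwdAvg_mul _ _ hG hi hφ.continuous hc]
  have h1 := hw _ (contDiff_backAvg (EuclideanSpace.single k 1) h hφ hc)
    (hasCompactSupport_backAvg (EuclideanSpace.single k 1) h hc)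
  rw [Function.iterate_succ_apply,
    funext (pderiv_backAvg k hh hφ hc), pderiv_iter_sub_shift _ _ _ hφ] at h1
  rw [h1]; ring

lemma integrable_fwdDiff (v : EuclideanSpace ℝ (Fin n))
    {F : EuclideanSpace ℝ (Fin n) → ℝ} (hF : Integrable F) : Integrable (fwdDiff v F) :=
  (hF.comp_add_right v).sub hF

lemma IsWeakDeriv.fwdDiff_iter_ae_eq {k : Fin n} {m : ℕ} {F G : EuclideanSpace ℝ (Fin n) → ℝ}
    (hw : IsWeakDeriv k m F G) (hF : Integrable F) (hG : Measurable G) (hi : Integrable G)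
    {h : ℝ} (hh : 0 ≤ h) :
    (_root_.fwdDiff (h • EuclideanSpace.single k (1 : ℝ)))^[m] F =ᵐ[volume]
      (fwdAvg (EuclideanSpace.single k 1) h)^[m] G := by
  induction m generalizing F G with
  | zero =>
    refine ae_eq_of_integral_contDiff_smul_eq hF.locallyIntegrable hi.locallyIntegrable
      fun φ hφ hc => ?_
    have := hw φ hφ hc
    simpa [mul_comm] using this
  | succ m ih =>
    exact ih (hw.fwdDiff hF hG hi hh) (integrable_fwdDiff _ hF) (measurable_fwdAvg _ _ hG)
      (integrable_fwdAvg _ _ hG hi)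

lemma lintegral_fwdAvg_mul_le (v : EuclideanSpace ℝ (Fin n)) (h : ℝ)
    {G : EuclideanSpace ℝ (Fin n) → ℝ} (hG : Measurable G)
    {w : EuclideanSpace ℝ (Fin n) → ℝ≥0∞} (hw : Measurable w) :
    ∫⁻ x, ‖fwdAvg v h G x‖ₑ * w x ≤ ∫⁻ x, ‖G x‖ₑ * ∫⁻ t in Ioc 0 h, w (x - t • v) := by
  calc ∫⁻ x, ‖fwdAvg v h G x‖ₑ * w x
      ≤ ∫⁻ x, ∫⁻ t in Ioc 0 h, ‖G (x + t • v)‖ₑ * w x := by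
        refine lintegral_mono fun x => ?_
        rw [lintegral_mul_const _ (by fun_prop)]
        gcongr
        exact enorm_integral_le_lintegral_enorm _
    _ = ∫⁻ t in Ioc 0 h, ∫⁻ x, ‖G (x + t • v)‖ₑ * w x :=
        lintegral_lintegral_swap (by fun_prop)
    _ = ∫⁻ t in Ioc 0 h, ∫⁻ x, ‖G x‖ₑ * w (x - t • v) := by
        refine lintegral_congr fun t => ?_
        have := lintegral_add_right_eq_self (μ := volume)
          (fun x => ‖G x‖ₑ * w (x - t • v)) (t • v)
        simpa using this
    _ = ∫⁻ x, ∫⁻ t in Ioc 0 h, ‖G x‖ₑ * w (x - t • v) :=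
        lintegral_lintegral_swap (by fun_prop)
    _ = _ := by
        refine lintegral_congr fun x => ?_
        rw [lintegral_const_mul _ (by fun_prop)]

lemma measurable_fwdAvg_iter (v : EuclideanSpace ℝ (Fin n)) (h : ℝ) (m : ℕ)
    {G : EuclideanSpace ℝ (Fin n) → ℝ} (hG : Measurable G) : Measurable ((fwdAvg v h)^[m] G) := by
  induction m generalizing G with
  | zero => exact hG
  | succ m ih => exact ih (measurable_fwdAvg v h hG)

lemma lintegral_fwdAvg_iter_mul_le (v : EuclideanSpace ℝ (Fin n)) (h : ℝ) (m : ℕ)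
    {G : EuclideanSpace ℝ (Fin n) → ℝ} (hG : Measurable G)
    {w : EuclideanSpace ℝ (Fin n) → ℝ≥0∞} (hw : Measurable w)
    (hinv : ∀ x (t : ℝ), w (x - t • v) = w x) :
    ∫⁻ x, ‖(fwdAvg v h)^[m] G x‖ₑ * w x ≤ ENNReal.ofReal h ^ m * ∫⁻ x, ‖G x‖ₑ * w x := by
  induction m generalizing G with
  | zero => simp
  | succ m ih =>
    calc _ ≤ ENNReal.ofReal h ^ m * ∫⁻ x, ‖fwdAvg v h G x‖ₑ * w x :=
          ih (measurable_fwdAvg v h hG)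
      _ ≤ ENNReal.ofReal h ^ m * ∫⁻ x, ‖G x‖ₑ * ∫⁻ t in Ioc 0 h, w (x - t • v) := by
          exact mul_le_mul' le_rfl (lintegral_fwdAvg_mul_le v h hG hw)
      _ = _ := by
          simp only [hinv, lintegral_const, Measure.restrict_apply MeasurableSet.univ, univ_inter,
            Real.volume_Ioc, sub_zero, ← mul_assoc]
          rw [lintegral_mul_const _ (by fun_prop)]
          ring

lemma lintegral_fwdAvg_iter_succ_mul_le (k : Fin n) (h : ℝ) (m : ℕ)
    {G : EuclideanSpace ℝ (Fin n) → ℝ} (hG : Measurable G)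
    {w : EuclideanSpace ℝ (Fin n) → ℝ≥0∞} (hw : Measurable w)
    (hinv : ∀ x (t : ℝ), w (x - t • EuclideanSpace.single k 1) = w x)
    {τ : ℝ → ℝ≥0∞} (hτ : Measurable τ) :
    ∫⁻ x, ‖(fwdAvg (EuclideanSpace.single k 1) h)^[m + 1] G x‖ₑ * (w x * τ (x k)) ≤
      ENNReal.ofReal h ^ m * (∫⁻ t, τ t) * ∫⁻ x, ‖G x‖ₑ * w x := by
  rw [Function.iterate_succ_apply']
  have hm : Measurable fun x : EuclideanSpace ℝ (Fin n) => x k := by fun_prop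
  calc _ ≤ ∫⁻ x, ‖(fwdAvg (EuclideanSpace.single k 1) h)^[m] G x‖ₑ *
          ∫⁻ t in Ioc 0 h, w (x - t • EuclideanSpace.single k 1) *
            τ ((x - t • EuclideanSpace.single k (1 : ℝ)) k) :=
        lintegral_fwdAvg_mul_le _ h (measurable_fwdAvg_iter _ _ _ hG) (hw.mul (hτ.comp hm))
    _ ≤ ∫⁻ x, (∫⁻ t, τ t) *
          (‖(fwdAvg (EuclideanSpace.single k 1) h)^[m] G x‖ₑ * w x) := by
        refine lintegral_mono fun x => ?_
        simp only [hinv]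
        rw [mul_left_comm]
        refine mul_le_mul' le_rfl ?_
        rw [lintegral_const_mul _ (by fun_prop), mul_comm]
        refine mul_le_mul' ?_ le_rfl
        refine (setLIntegral_le_lintegral _ _).trans ?_
        have := lintegral_sub_left_eq_self (μ := volume) τ (x k)
        simpa using this.le
    _ ≤ _ := by
        have := (measurable_fwdAvg_iter (EuclideanSpace.single k (1 : ℝ)) h m hG).enorm
        rw [lintegral_const_mul _ (by fun_prop), mul_comm (_ ^ m), mul_assoc]
        refine mul_le_mul' le_rfl ?_
        exact lintegral_fwdAvg_iter_mul_le _ h m hG hw hinv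

/-- `∑ᵢ C(s,i) ψ(t + i h)`. -/
noncomputable def binSum (s : ℕ) (h : ℝ) (ψ : ℝ → ℝ≥0∞) (t : ℝ) : ℝ≥0∞ :=
  ∑ i ∈ Finset.range (s + 1), (s.choose i : ℝ≥0∞) * ψ (t + i * h)

lemma measurable_binSum (s : ℕ) (h : ℝ) {ψ : ℝ → ℝ≥0∞} (hψ : Measurable ψ) :
    Measurable (binSum s h ψ) := by
  unfold binSum; fun_prop

lemma lintegral_mul_binSum_neg (s : ℕ) (h : ℝ) {ψ θ : ℝ → ℝ≥0∞} (hψ : Measurable ψ)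
    (hθ : Measurable θ) :
    ∫⁻ t, ψ t * binSum s (-h) θ t = ∫⁻ t, binSum s h ψ t * θ t := by
  simp only [binSum, Finset.mul_sum, Finset.sum_mul]
  rw [lintegral_finsetSum _ (fun i _ => by fun_prop), lintegral_finsetSum _ (fun i _ => by fun_prop)]
  refine Finset.sum_congr rfl fun i _ => ?_
  have := lintegral_add_right_eq_self (μ := volume)
    (fun t => ψ t * ((s.choose i : ℝ≥0∞) * θ (t + i * (-h)))) (i * h)
  rw [← this]
  refine lintegral_congr fun t => ?_
  rw [mul_neg, add_neg_cancel_right]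
  ring

lemma enorm_fwdDiff_iter_le (v : EuclideanSpace ℝ (Fin n)) (s : ℕ)
    (H : EuclideanSpace ℝ (Fin n) → ℝ) (x : EuclideanSpace ℝ (Fin n)) :
    ‖(fwdDiff v)^[s] H x‖ₑ ≤
      ∑ i ∈ Finset.range (s + 1), (s.choose i : ℝ≥0∞) * ‖H (x + i • v)‖ₑ := by
  rw [fwdDiff_iter_eq_sum_shift]
  refine (enorm_sum_le _ _).trans (Finset.sum_le_sum fun i _ => ?_)
  rw [zsmul_eq_mul, enorm_mul]
  gcongr
  rw [← ofReal_norm, Real.norm_eq_abs]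
  push_cast
  rw [abs_mul, abs_pow, abs_neg, abs_one, one_pow, one_mul, Nat.abs_cast]
  simp

lemma lintegral_fwdDiff_iter_mul_le (v : EuclideanSpace ℝ (Fin n)) (s : ℕ)
    {H : EuclideanSpace ℝ (Fin n) → ℝ} (hH : Measurable H)
    {w : EuclideanSpace ℝ (Fin n) → ℝ≥0∞} (hw : Measurable w) :
    ∫⁻ x, ‖(fwdDiff v)^[s] H x‖ₑ * w x ≤
      ∫⁻ x, ‖H x‖ₑ * ∑ i ∈ Finset.range (s + 1), (s.choose i : ℝ≥0∞) * w (x - i • v) := by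
  calc _ ≤ ∫⁻ x, ∑ i ∈ Finset.range (s + 1), (s.choose i : ℝ≥0∞) * ‖H (x + i • v)‖ₑ * w x := by
        refine lintegral_mono fun x => ?_
        dsimp only
        rw [← Finset.sum_mul]
        gcongr
        exact enorm_fwdDiff_iter_le v s H x
    _ = _ := by
        simp only [Finset.mul_sum]
        rw [lintegral_finsetSum _ (fun i _ => by fun_prop),
          lintegral_finsetSum _ (fun i _ => by fun_prop)]
        refine Finset.sum_congr rfl fun i _ => ?_
        rw [← lintegral_add_right_eq_self (μ := volume)
          (fun x => ‖H x‖ₑ * ((s.choose i : ℝ≥0∞) * w (x - i • v))) (i • v)]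
        refine lintegral_congr fun x => ?_
        rw [add_sub_cancel_right]
        ring

lemma mixed_diff_marginal_le {p q : Fin n} (hpq : q ≠ p) (sp sq : ℕ) (hp hq : ℝ)
    {G u : EuclideanSpace ℝ (Fin n) → ℝ} (hG : Measurable G)
    (hu : u =ᵐ[volume] (fwdDiff (hq • EuclideanSpace.single q (1 : ℝ)))^[sq]
      ((fwdAvg (EuclideanSpace.single p 1) hp)^[sp] G))
    {ψ : ℝ → ℝ≥0∞} (hψ : Measurable ψ)
    (hm : ∀ θ : ℝ → ℝ≥0∞, Measurable θ → ∫⁻ x, ‖G x‖ₑ * θ (x q) = ∫⁻ t, ψ t * θ t)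
    {θ : ℝ → ℝ≥0∞} (hθ : Measurable θ) :
    ∫⁻ x, ‖u x‖ₑ * θ (x q) ≤ ENNReal.ofReal hp ^ sp * ∫⁻ t, binSum sq hq ψ t * θ t := by
  have hmq : Measurable fun x : EuclideanSpace ℝ (Fin n) => x q := by fun_prop
  rw [lintegral_congr_ae (hu.mono fun x hx => by
    show ‖u x‖ₑ * θ (x q) = _
    rw [hx])]
  refine (lintegral_fwdDiff_iter_mul_le _ sq (measurable_fwdAvg_iter _ _ _ hG)
    (hθ.comp hmq)).trans ?_
  have e1 : ∀ x : EuclideanSpace ℝ (Fin n), ∑ i ∈ Finset.range (sq + 1),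
      (sq.choose i : ℝ≥0∞) * (θ ∘ fun x : EuclideanSpace ℝ (Fin n) => x q)
        (x - i • hq • EuclideanSpace.single q (1 : ℝ)) = binSum sq (-hq) θ (x q) := by
    intro x
    simp [binSum, sub_eq_add_neg]
  simp only [e1]
  refine (lintegral_fwdAvg_iter_mul_le _ _ _ hG ((measurable_binSum sq _ hθ).comp hmq)
    fun x t => ?_).trans ?_
  · simp [hpq]
  · simp only [Function.comp_def]
    rw [hm _ (measurable_binSum _ _ hθ), lintegral_mul_binSum_neg _ _ hψ hθ]

lemma mixed_diff_marginal_mul_le {p q : Fin n} (hpq : q ≠ p) (m sq : ℕ) (hp hq : ℝ)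
    {G u : EuclideanSpace ℝ (Fin n) → ℝ} (hG : Measurable G)
    (hu : u =ᵐ[volume] (fwdDiff (hq • EuclideanSpace.single q (1 : ℝ)))^[sq]
      ((fwdAvg (EuclideanSpace.single p 1) hp)^[m + 1] G))
    {ψ : ℝ → ℝ≥0∞} (hψ : Measurable ψ)
    (hm : ∀ θ : ℝ → ℝ≥0∞, Measurable θ → ∫⁻ x, ‖G x‖ₑ * θ (x q) = ∫⁻ t, ψ t * θ t)
    {θ τ : ℝ → ℝ≥0∞} (hθ : Measurable θ) (hτ : Measurable τ) :
    ∫⁻ x, ‖u x‖ₑ * (θ (x q) * τ (x p)) ≤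
      ENNReal.ofReal hp ^ m * (∫⁻ t, τ t) * ∫⁻ t, binSum sq hq ψ t * θ t := by
  have hmq : Measurable fun x : EuclideanSpace ℝ (Fin n) => x q := by fun_prop
  have hmp : Measurable fun x : EuclideanSpace ℝ (Fin n) => x p := by fun_prop
  rw [lintegral_congr_ae (hu.mono fun x hx => by
    show ‖u x‖ₑ * (θ (x q) * τ (x p)) = _
    rw [hx])]
  refine (lintegral_fwdDiff_iter_mul_le _ sq (measurable_fwdAvg_iter _ _ _ hG)
    (w := fun x => θ (x q) * τ (x p)) ((hθ.comp hmq).mul (hτ.comp hmp))).trans ?_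
  have e1 : ∀ x : EuclideanSpace ℝ (Fin n), ∑ i ∈ Finset.range (sq + 1),
      (sq.choose i : ℝ≥0∞) * (θ ((x - i • hq • EuclideanSpace.single q (1 : ℝ)) q) *
        τ ((x - i • hq • EuclideanSpace.single q (1 : ℝ)) p)) =
      binSum sq (-hq) θ (x q) * τ (x p) := by
    intro x
    simp [binSum, sub_eq_add_neg, hpq.symm, Finset.sum_mul, mul_assoc]
  simp only [e1]
  refine (lintegral_fwdAvg_iter_succ_mul_le p hp m hG (w := fun x => binSum sq (-hq) θ (x q))
    ((measurable_binSum sq _ hθ).comp hmq) (fun x t => ?_) hτ).trans ?_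
  · simp [hpq]
  · rw [hm _ (measurable_binSum _ _ hθ), lintegral_mul_binSum_neg _ _ hψ hθ]

lemma exists_marginal_density (k : Fin n) {G : EuclideanSpace ℝ (Fin n) → ℝ}
    (hG : Measurable G) (hi : Integrable G) :
    ∃ ψ : ℝ → ℝ≥0∞, Measurable ψ ∧ ∀ θ : ℝ → ℝ≥0∞, Measurable θ →
      ∫⁻ x, ‖G x‖ₑ * θ (x k) = ∫⁻ t, ψ t * θ t := by
  have hmk : Measurable fun x : EuclideanSpace ℝ (Fin n) => x k := by fun_prop
  set μ : Measure (EuclideanSpace ℝ (Fin n)) := volume.withDensity fun x => ‖G x‖ₑ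
  have hμ : IsFiniteMeasure μ := isFiniteMeasure_withDensity hi.2.ne
  set ν := μ.map fun x : EuclideanSpace ℝ (Fin n) => x k
  have hν : IsFiniteMeasure ν := Measure.isFiniteMeasure_map _ _
  have hac : ν ≪ volume := by
    have h1 : Measure.QuasiMeasurePreserving (fun x : EuclideanSpace ℝ (Fin n) => x k)
        volume volume :=
      (Measure.quasiMeasurePreserving_eval (fun _ : Fin n => (volume : Measure ℝ)) k).comp
        (PiLp.volume_preserving_ofLp (Fin n)).quasiMeasurePreserving
    exact ((withDensity_absolutelyContinuous _ _).map hmk).trans h1.absolutelyContinuous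
  refine ⟨ν.rnDeriv volume, Measure.measurable_rnDeriv _ _, fun θ hθ => ?_⟩
  rw [lintegral_rnDeriv_mul hac hθ.aemeasurable, lintegral_map hθ hmk]
  exact (lintegral_withDensity_eq_lintegral_mul volume hG.enorm (hθ.comp hmk)).symm

/-- `2 ^ t` as an extended nonnegative real. -/
noncomputable def twoPow (t : ℝ) : ℝ≥0∞ := (2 : ℝ≥0∞) ^ t

lemma twoPow_add (s t : ℝ) : twoPow (s + t) = twoPow s * twoPow t :=
  ENNReal.rpow_add _ _ (by norm_num) (by norm_num)

@[simp] lemma twoPow_zero : twoPow 0 = 1 := ENNReal.rpow_zero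

lemma twoPow_pos (t : ℝ) : 0 < twoPow t := ENNReal.rpow_pos (by norm_num) (by norm_num)

lemma twoPow_ne_zero (t : ℝ) : twoPow t ≠ 0 := (twoPow_pos t).ne'

lemma twoPow_ne_top (t : ℝ) : twoPow t ≠ ⊤ :=
  ENNReal.rpow_ne_top_of_ne_zero (by norm_num) (by norm_num)

lemma twoPow_mono : Monotone twoPow := fun _ _ h =>
  ENNReal.rpow_le_rpow_of_exponent_le (by norm_num) h

lemma twoPow_lt_iff {s t : ℝ} : twoPow s < twoPow t ↔ s < t :=
  (show StrictMono twoPow from fun _ _ h =>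
    ENNReal.rpow_lt_rpow_of_exponent_lt (by norm_num) (by norm_num) h).lt_iff_lt

lemma twoPow_eq_ofReal (t : ℝ) : twoPow t = ENNReal.ofReal (2 ^ t) := by
  rw [← ENNReal.ofReal_rpow_of_pos (by norm_num)]; simp [twoPow]

lemma twoPow_mul (s t : ℝ) : twoPow (s * t) = twoPow s ^ t := ENNReal.rpow_mul _ _ _

lemma twoPow_one : twoPow 1 = 2 := ENNReal.rpow_one _

/-- The two-sided geometric sum `∑ 2 ^ (-δ |k|)`. -/
noncomputable def geomSum (δ : ℝ) : ℝ≥0∞ := ∑' k : ℤ, twoPow (-(δ * |(k : ℝ)|))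

lemma geomSum_ne_top {δ : ℝ} (hδ : 0 < δ) : geomSum δ ≠ ⊤ := by
  have hs : Summable fun k : ℕ => ((2 : ℝ) ^ (-δ)) ^ k :=
    summable_geometric_of_lt_one (by positivity)
      (Real.rpow_lt_one_of_one_lt_of_neg (by norm_num) (by linarith))
  have hs' : Summable fun k : ℕ => (2 : ℝ) ^ (-(δ * (k : ℝ))) := by
    refine hs.congr fun k => ?_
    rw [← Real.rpow_natCast, ← Real.rpow_mul (by norm_num)]
    ring_nf
  have h3 : Summable fun k : ℤ => (2 : ℝ) ^ (-(δ * |(k : ℝ)|)) :=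
    Summable.of_nat_of_neg (by simpa using hs') (by simpa using hs')
  simp only [geomSum, twoPow_eq_ofReal]
  rw [← ENNReal.ofReal_tsum_of_nonneg (fun k => by positivity) h3]
  exact ENNReal.ofReal_ne_top

lemma tsum_twoPow_sub (δ : ℝ) (c : ℤ) :
    ∑' k : ℤ, twoPow (-(δ * |(k : ℝ) - c|)) = geomSum δ := by
  rw [geomSum, ← (Equiv.subRight c).tsum_eq fun k : ℤ => twoPow (-(δ * |(k : ℝ)|))]
  simp

lemma tsum_twoPow_sub' (δ : ℝ) (c : ℤ) :
    ∑' k : ℤ, twoPow (-(δ * |(c : ℝ) - k|)) = geomSum δ := by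
  simp only [abs_sub_comm (c : ℝ)]
  exact tsum_twoPow_sub δ c

lemma exists_twoPow_lt_le {V : ℝ≥0∞} (h0 : V ≠ 0) (ht : V ≠ ⊤) :
    ∃ k : ℤ, twoPow k < V ∧ V ≤ twoPow (k + 1) := by
  obtain ⟨k, h1, h2⟩ := ENNReal.exists_mem_Ioc_zpow h0 ht (y := 2) (by norm_num) (by norm_num)
  refine ⟨k, ?_, ?_⟩
  · rwa [twoPow, ENNReal.rpow_intCast]
  · rw [twoPow, ← Int.cast_one, ← Int.cast_add, ENNReal.rpow_intCast]; exact h2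

lemma tsum_twoPow_of_lt (V : ℝ≥0∞) :
    ∑' k : ℤ, (if twoPow (-k) < V then twoPow (-k) else 0) ≤ geomSum 1 * V := by
  rcases eq_or_ne V 0 with rfl | h0
  · simp
  rcases eq_or_ne V ⊤ with rfl | ht
  · rw [ENNReal.mul_top]
    · exact le_top
    · intro h
      have := ENNReal.tsum_eq_zero.1 h 0
      exact twoPow_ne_zero _ this
  obtain ⟨c, h1, h2⟩ := exists_twoPow_lt_le h0 ht
  rw [← tsum_twoPow_sub 1 (-c), ← ENNReal.tsum_mul_right]
  refine ENNReal.tsum_le_tsum fun k => ?_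
  split_ifs with h
  · have h3 : -(k : ℝ) < c + 1 := twoPow_lt_iff.1 (h.trans_le h2)
    have h4 : -k ≤ c := by
      have : -k < c + 1 := by exact_mod_cast h3
      omega
    have h5 : (0 : ℝ) ≤ k - ((-c : ℤ) : ℝ) := by
      have : -(k : ℝ) ≤ c := by exact_mod_cast h4
      push_cast; linarith
    rw [abs_of_nonneg h5]
    calc twoPow (-k) = twoPow (-(1 * (k - ((-c : ℤ) : ℝ)))) * twoPow c := by
          rw [← twoPow_add]; congr 1; push_cast; ring
      _ ≤ _ := by gcongr
  · exact zero_le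

lemma lintegral_Ioi_indicator_lt (c : ℝ≥0∞) :
    ∫⁻ t in Ioi (0 : ℝ), (if ENNReal.ofReal t < c then 1 else 0) = c := by
  have h : ∀ t : ℝ, (if ENNReal.ofReal t < c then (1 : ℝ≥0∞) else 0) =
      {t : ℝ | ENNReal.ofReal t < c}.indicator 1 t := fun t => by simp [indicator]
  have hm : MeasurableSet {t : ℝ | ENNReal.ofReal t < c} :=
    measurableSet_lt ENNReal.measurable_ofReal measurable_const
  simp only [h]
  rw [lintegral_indicator_one hm, Measure.restrict_apply hm]
  rcases eq_or_ne c ⊤ with rfl | hc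
  · simp
  · have : {t : ℝ | ENNReal.ofReal t < c} ∩ Ioi 0 = Ioo 0 c.toReal := by
      ext t
      simp only [mem_inter_iff, mem_ofPred_eq, mem_Ioi, mem_Ioo]
      constructor
      · rintro ⟨h1, h2⟩
        exact ⟨h2, (ENNReal.ofReal_lt_iff_lt_toReal h2.le hc).1 h1⟩
      · rintro ⟨h1, h2⟩
        exact ⟨(ENNReal.ofReal_lt_iff_lt_toReal h1.le hc).2 h2, h1⟩
    rw [this]; simp [hc]

lemma lintegral_measure_lt_eq {ψ : ℝ → ℝ≥0∞} (hψ : Measurable ψ) :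
    ∫⁻ t in Ioi (0 : ℝ), volume {x | ENNReal.ofReal t < ψ x} = ∫⁻ x, ψ x := by
  have h1 : ∀ t : ℝ, volume {x | ENNReal.ofReal t < ψ x} =
      ∫⁻ x, (if ENNReal.ofReal t < ψ x then 1 else 0) := fun t => by
    have hm : MeasurableSet {x | ENNReal.ofReal t < ψ x} := measurableSet_lt measurable_const hψ
    rw [← lintegral_indicator_one hm]
    refine lintegral_congr fun x => ?_
    simp [indicator]
  simp only [h1]
  rw [lintegral_lintegral_swap]
  · exact lintegral_congr fun x => lintegral_Ioi_indicator_lt _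
  · refine (Measurable.ite (measurableSet_lt ?_ ?_) measurable_const
      measurable_const).aemeasurable
    · exact ENNReal.measurable_ofReal.comp measurable_fst
    · exact hψ.comp measurable_snd

/-- The decreasing rearrangement of `ψ` at `2 ^ (-k)`. -/
noncomputable def rearr (ψ : ℝ → ℝ≥0∞) (k : ℤ) : ℝ≥0∞ :=
  sInf {l : ℝ≥0∞ | volume {t | l < ψ t} ≤ twoPow (-k)}

lemma rearr_mono (ψ : ℝ → ℝ≥0∞) : Monotone (rearr ψ) := fun i j hij =>
  sInf_le_sInf fun _ hl => hl.trans (twoPow_mono (by simpa using hij))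

lemma volume_rearr_lt_le (ψ : ℝ → ℝ≥0∞) (k : ℤ) :
    volume {t | rearr ψ k < ψ t} ≤ twoPow (-k) := by
  rcases eq_or_ne (rearr ψ k) ⊤ with h | h
  · simp [h]
  obtain ⟨u, hu, hlt, hlim⟩ := exists_seq_strictAnti_tendsto' (h.lt_top)
  have hset : {t | rearr ψ k < ψ t} = ⋃ j, {t | u j < ψ t} := by
    ext t
    simp only [mem_ofPred_eq, mem_iUnion]
    refine ⟨fun ht => (hlim.eventually_lt_const ht).exists, fun ⟨j, hj⟩ => (hlt j).1.trans hj⟩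
  have hmono : Monotone fun j => {t | u j < ψ t} := fun i j hij t ht =>
    (hu.antitone hij).trans_lt ht
  rw [hset, hmono.measure_iUnion]
  refine iSup_le fun j => ?_
  obtain ⟨l, hl, hlu⟩ := sInf_lt_iff.1 (hlt j).1
  exact (measure_mono fun t (ht : u j < ψ t) => hlu.trans ht).trans hl

lemma tsum_twoPow_mul_rearr_le {ψ : ℝ → ℝ≥0∞} (hψ : Measurable ψ) :
    ∑' k : ℤ, twoPow (-k) * rearr ψ k ≤ geomSum 1 * ∫⁻ t, ψ t := by
  have hm : ∀ k, Measurable fun t : ℝ => if ENNReal.ofReal t < rearr ψ k then (1 : ℝ≥0∞) else 0 :=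
    fun k => Measurable.ite (measurableSet_lt ENNReal.measurable_ofReal measurable_const)
      measurable_const measurable_const
  calc ∑' k : ℤ, twoPow (-k) * rearr ψ k
      = ∑' k : ℤ, ∫⁻ t in Ioi (0 : ℝ),
          twoPow (-k) * (if ENNReal.ofReal t < rearr ψ k then 1 else 0) := by
        refine tsum_congr fun k => ?_
        rw [lintegral_const_mul _ (hm k), lintegral_Ioi_indicator_lt]
    _ = ∫⁻ t in Ioi (0 : ℝ), ∑' k : ℤ,
          twoPow (-k) * (if ENNReal.ofReal t < rearr ψ k then 1 else 0) := by
        rw [lintegral_tsum fun k => ((hm k).const_mul _).aemeasurable]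
    _ ≤ ∫⁻ t in Ioi (0 : ℝ), geomSum 1 * volume {x | ENNReal.ofReal t < ψ x} := by
        refine lintegral_mono fun t => le_trans (ENNReal.tsum_le_tsum fun k => ?_)
          (tsum_twoPow_of_lt _)
        rw [mul_ite, mul_one, mul_zero]
        split_ifs with h1 h2
        · exact le_rfl
        · exact absurd (sInf_le (show ENNReal.ofReal t ∈
            {l : ℝ≥0∞ | volume {x | l < ψ x} ≤ twoPow (-k)} from not_lt.1 h2)) (not_le.2 h1)
        · exact zero_le
        · exact le_rfl
    _ = _ := by
        have hanti : Antitone fun t : ℝ => volume {x | ENNReal.ofReal t < ψ x} :=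
          fun s t hst => measure_mono fun x (hx : _ < _) =>
            (ENNReal.ofReal_le_ofReal hst).trans_lt hx
        rw [lintegral_const_mul _ hanti.measurable, lintegral_measure_lt_eq hψ]

/-- Points at which one of the shifts of `ψ` exceeds the `k`-th rearrangement level. -/
def superLevel (s : ℕ) (h : ℝ) (ψ : ℝ → ℝ≥0∞) (k : ℤ) : Set ℝ :=
  {t | ∃ i ∈ Finset.range (s + 1), rearr ψ k < ψ (t + i * h)}

lemma superLevel_eq (s : ℕ) (h : ℝ) (ψ : ℝ → ℝ≥0∞) (k : ℤ) :
    superLevel s h ψ k =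
      ⋃ i ∈ Finset.range (s + 1), (fun t : ℝ => t + i * h) ⁻¹' {t | rearr ψ k < ψ t} := by
  ext t; simp [superLevel]

lemma measurableSet_superLevel (s : ℕ) (h : ℝ) {ψ : ℝ → ℝ≥0∞} (hψ : Measurable ψ) (k : ℤ) :
    MeasurableSet (superLevel s h ψ k) := by
  rw [superLevel_eq]
  exact Finset.measurableSet_biUnion _ fun i _ =>
    (measurableSet_lt measurable_const hψ).preimage (measurable_id.add_const _)

lemma volume_superLevel_le (s : ℕ) (h : ℝ) (ψ : ℝ → ℝ≥0∞) (k : ℤ) :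
    volume (superLevel s h ψ k) ≤ (s + 1 : ℕ) * twoPow (-k) := by
  rw [superLevel_eq]
  refine (measure_biUnion_finset_le _ _).trans ?_
  simp only [measure_preimage_add_right]
  refine (Finset.sum_le_sum fun i _ => volume_rearr_lt_le ψ k).trans ?_
  simp

lemma superLevel_anti (s : ℕ) (h : ℝ) (ψ : ℝ → ℝ≥0∞) : Antitone (superLevel s h ψ) :=
  fun _ _ hij _ ⟨l, hl, hlt⟩ => ⟨l, hl, (rearr_mono ψ hij).trans_lt hlt⟩

lemma binSum_le_of_notMem (s : ℕ) (h : ℝ) (ψ : ℝ → ℝ≥0∞) {k : ℤ} {t : ℝ}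
    (ht : t ∉ superLevel s h ψ k) : binSum s h ψ t ≤ 2 ^ s * rearr ψ k := by
  have : ∀ i ∈ Finset.range (s + 1), ψ (t + i * h) ≤ rearr ψ k := fun i hi =>
    not_lt.1 fun hlt => ht ⟨i, hi, hlt⟩
  calc binSum s h ψ t ≤ ∑ i ∈ Finset.range (s + 1), (s.choose i : ℝ≥0∞) * rearr ψ k :=
        Finset.sum_le_sum fun i hi => mul_le_mul' le_rfl (this i hi)
    _ = _ := by
        rw [← Finset.sum_mul, ← Nat.cast_sum, Nat.sum_range_choose]; simp

/-- The shell on which `binSum s h ψ` is comparable to the `k`-th rearrangement level. -/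
def levelShell (s : ℕ) (h : ℝ) (ψ : ℝ → ℝ≥0∞) (k : ℤ) : Set ℝ :=
  superLevel s h ψ k \ superLevel s h ψ (k + 1)

lemma measurableSet_levelShell (s : ℕ) (h : ℝ) {ψ : ℝ → ℝ≥0∞} (hψ : Measurable ψ) (k : ℤ) :
    MeasurableSet (levelShell s h ψ k) :=
  (measurableSet_superLevel s h hψ k).diff (measurableSet_superLevel s h hψ (k + 1))

lemma volume_levelShell_le (s : ℕ) (h : ℝ) (ψ : ℝ → ℝ≥0∞) (k : ℤ) :
    volume (levelShell s h ψ k) ≤ (s + 1 : ℕ) * twoPow (-k) :=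
  (measure_mono sdiff_subset).trans (volume_superLevel_le s h ψ k)

lemma pairwise_disjoint_levelShell (s : ℕ) (h : ℝ) (ψ : ℝ → ℝ≥0∞) :
    Pairwise (Function.onFun Disjoint (levelShell s h ψ)) := by
  have key : ∀ i j : ℤ, i < j → Disjoint (levelShell s h ψ i) (levelShell s h ψ j) :=
    fun i j hij => Set.disjoint_left.2 fun t hi hj =>
      hi.2 (superLevel_anti s h ψ (by omega : i + 1 ≤ j) hj.1)
  intro i j hij
  rcases lt_or_gt_of_ne hij with hlt | hlt
  · exact key i j hlt
  · exact (key j i hlt).symm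

lemma binSum_eq_zero_of_forall_notMem (s : ℕ) (h : ℝ) {ψ : ℝ → ℝ≥0∞} (hψ : Measurable ψ)
    (hfin : ∫⁻ t, ψ t ≠ ⊤) {t : ℝ} (ht : ∀ k, t ∉ superLevel s h ψ k) : binSum s h ψ t = 0 := by
  set C := geomSum 1 * ∫⁻ t, ψ t
  have hC : C ≠ ⊤ := ENNReal.mul_ne_top (geomSum_ne_top one_pos) hfin
  have h1 : ∀ k : ℕ, binSum s h ψ t ≤ 2 ^ s * (C * (2⁻¹) ^ k) := fun k => by
    refine (binSum_le_of_notMem s h ψ (ht (-(k : ℤ)))).trans ?_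
    gcongr
    have h2 : twoPow (-((-(k : ℤ) : ℤ) : ℝ)) * rearr ψ (-(k : ℤ)) ≤ C :=
      (ENNReal.le_tsum (f := fun k : ℤ => twoPow (-k) * rearr ψ k) (-(k : ℤ))).trans
        (tsum_twoPow_mul_rearr_le hψ)
    have h3 : twoPow (-((-(k : ℤ) : ℤ) : ℝ)) = 2 ^ k := by
      simp [twoPow, ENNReal.rpow_natCast]
    rw [h3] at h2
    calc rearr ψ (-(k : ℤ)) = (2 ^ k * rearr ψ (-(k : ℤ))) * (2⁻¹) ^ k := by
          rw [mul_right_comm, ← mul_pow, ENNReal.mul_inv_cancel (by norm_num) (by norm_num)]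
          simp
      _ ≤ _ := by gcongr
  have h2 : Filter.Tendsto (fun k : ℕ => 2 ^ s * (C * (2⁻¹ : ℝ≥0∞) ^ k)) Filter.atTop
      (nhds (2 ^ s * (C * 0))) := by
    refine ENNReal.Tendsto.const_mul (ENNReal.Tendsto.const_mul ?_ (Or.inr hC))
      (Or.inr (by simp))
    exact ENNReal.tendsto_pow_atTop_nhds_zero_of_lt_one (by norm_num)
  simp only [mul_zero] at h2
  exact le_antisymm (ge_of_tendsto' h2 h1) zero_le

lemma ae_binSum_eq_zero_of_notMem_levelShell (s : ℕ) (h : ℝ) {ψ : ℝ → ℝ≥0∞} (hψ : Measurable ψ)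
    (hfin : ∫⁻ t, ψ t ≠ ⊤) :
    ∀ᵐ t, (∀ k, t ∉ levelShell s h ψ k) → binSum s h ψ t = 0 := by
  have hnull : volume (⋂ j : ℕ, superLevel s h ψ j) = 0 := by
    have h1 : ∀ j : ℕ, volume (⋂ j : ℕ, superLevel s h ψ j) ≤ (s + 1 : ℕ) * (2⁻¹) ^ j := fun j =>
      (measure_mono (iInter_subset _ j)).trans <| (volume_superLevel_le s h ψ j).trans (by
        gcongr
        rw [twoPow, ENNReal.rpow_neg, Int.cast_natCast, ENNReal.rpow_natCast, ENNReal.inv_pow])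
    have h2 : Filter.Tendsto (fun k : ℕ => ((s + 1 : ℕ) : ℝ≥0∞) * (2⁻¹ : ℝ≥0∞) ^ k) Filter.atTop
        (nhds ((s + 1 : ℕ) * 0)) :=
      ENNReal.Tendsto.const_mul (ENNReal.tendsto_pow_atTop_nhds_zero_of_lt_one (by norm_num))
        (Or.inr (by simp))
    rw [mul_zero] at h2
    exact le_antisymm (ge_of_tendsto' h2 h1) zero_le
  have hae : ∀ᵐ t, t ∉ ⋂ j : ℕ, superLevel s h ψ j := measure_eq_zero_iff_ae_notMem.1 hnull
  filter_upwards [hae] with t ht hk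
  refine binSum_eq_zero_of_forall_notMem s h hψ hfin fun k hmem => ht ?_
  have hup : ∀ j : ℕ, t ∈ superLevel s h ψ (k + j) := fun j => by
    induction j with
    | zero => simpa using hmem
    | succ j ih =>
      by_contra hne
      exact hk (k + j) ⟨ih, by push_cast at hne; rwa [← add_assoc] at hne⟩
  exact mem_iInter.2 fun j =>
    superLevel_anti s h ψ (by omega : (j : ℤ) ≤ k + ((j - k).toNat : ℕ)) (hup _)

open scoped FourierTransform in
lemma toLp_fourier_ae_eq {f : ℝ → ℂ} (hf : Integrable f) (hf2 : MemLp f 2) :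
    (𝓕 (hf2.toLp f) : Lp ℂ 2 (volume : Measure ℝ)) =ᵐ[volume] 𝓕 f := by
  have hcont : Continuous (𝓕 f) :=
    VectorFourier.fourierIntegral_continuous Real.continuous_fourierChar
      (L := innerₗ ℝ) continuous_inner hf
  have hloc : LocallyIntegrable (𝓕 (hf2.toLp f) : Lp ℂ 2 (volume : Measure ℝ)) volume :=
    (Lp.memLp _).locallyIntegrable (by norm_num)
  refine ae_eq_of_integral_contDiff_smul_eq hloc hcont.locallyIntegrable fun g hg hc => ?_
  set G : ℝ → ℂ := fun x => (g x : ℂ) with hG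
  have hGc : HasCompactSupport G := hc.comp_left (g := fun x : ℝ => (x : ℂ)) (by simp)
  have hGs : ContDiff ℝ (⊤ : ℕ∞) G := Complex.ofRealCLM.contDiff.comp hg
  set φ : SchwartzMap ℝ ℂ := hGc.toSchwartzMap hGs
  have hφ : ∀ x, φ x = G x := fun x => rfl
  have h1 := congrArg (fun T : TemperedDistribution ℝ ℂ => T φ)
    (Lp.fourier_toTemperedDistribution_eq (hf2.toLp f))
  simp only [TemperedDistribution.fourier_apply, Lp.toTemperedDistribution_apply] at h1
  have h2 := VectorFourier.integral_fourierIntegral_smul_eq_flip (μ := volume) (ν := volume)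
    (f := f) (g := G) (L := innerₗ ℝ) Real.continuous_fourierChar
    continuous_inner hf φ.integrable
  have h3 : ∫ x, g x • (𝓕 f) x = ∫ x, f x • (𝓕 φ) x := by
    have e1 : ∀ x, 𝓕 φ x = VectorFourier.fourierIntegral Real.fourierChar volume
        (innerₗ ℝ).flip G x := fun x => by
      rw [flip_innerₗ]; rfl
    simp only [e1]
    rw [← h2]
    refine integral_congr_ae (Filter.Eventually.of_forall fun x => ?_)
    change g x • (𝓕 f) x = (𝓕 f) x • (g x : ℂ)
    rw [smul_eq_mul, mul_comm, Complex.real_smul]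
  rw [h3]
  have h4 : ∫ x, g x • (𝓕 (hf2.toLp f) : Lp ℂ 2 (volume : Measure ℝ)) x =
    ∫ x, φ x • (𝓕 (hf2.toLp f) : Lp ℂ 2 (volume : Measure ℝ)) x := by
    simp [hφ, hG]
  rw [h4, ← h1]
  refine integral_congr_ae ?_
  filter_upwards [hf2.coeFn_toLp] with x hx
  rw [hx, smul_eq_mul, smul_eq_mul, mul_comm]

open scoped FourierTransform in
lemma lintegral_enorm_fourier_sq {f : ℝ → ℂ} (hf : Integrable f) (hf2 : MemLp f 2) :
    ∫⁻ x, ‖𝓕 f x‖ₑ ^ (2 : ℝ) = ∫⁻ x, ‖f x‖ₑ ^ (2 : ℝ) := by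
  have h := congrArg ENNReal.ofReal (Lp.norm_fourier_eq (hf2.toLp f))
  rw [Lp.norm_def, Lp.norm_def, ENNReal.ofReal_toReal (Lp.eLpNorm_ne_top _),
    ENNReal.ofReal_toReal (Lp.eLpNorm_ne_top _),
    eLpNorm_congr_ae (toLp_fourier_ae_eq hf hf2), eLpNorm_congr_ae hf2.coeFn_toLp,
    eLpNorm_eq_lintegral_rpow_enorm_toReal (by norm_num) (by norm_num),
    eLpNorm_eq_lintegral_rpow_enorm_toReal (by norm_num) (by norm_num)] at h
  have := ENNReal.rpow_left_injective (x := 1 / (2 : ℝ≥0∞).toReal) (by norm_num) h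
  simpa using this

open scoped FourierTransform in
lemma fourierTf_eq_fourier (f : EuclideanSpace ℝ (Fin n) → ℂ) : fourierTf f = 𝓕 f := by
  funext ξ
  rw [Real.fourier_eq', fourierTf]
  simp only [smul_eq_mul]
  refine integral_congr_ae (Filter.Eventually.of_forall fun x => ?_)
  dsimp only
  congr 4
  ring

lemma continuous_fourierTf {f : EuclideanSpace ℝ (Fin n) → ℂ} (hf : Integrable f) :
    Continuous (fourierTf f) := by
  rw [fourierTf_eq_fourier]
  exact VectorFourier.fourierIntegral_continuous Real.continuous_fourierChar
    (L := innerₗ _) continuous_inner hf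

lemma enorm_exp_neg_inner_mul (x ξ : EuclideanSpace ℝ (Fin n)) :
    ‖Complex.exp (((-(2 * Real.pi * (@inner ℝ _ _ x ξ)) : ℝ) : ℂ) * Complex.I)‖ₑ = 1 := by
  rw [← ofReal_norm, Complex.norm_exp_ofReal_mul_I, ENNReal.ofReal_one]

lemma enorm_fourierTf_le (f : EuclideanSpace ℝ (Fin n) → ℂ) (ξ : EuclideanSpace ℝ (Fin n)) :
    ‖fourierTf f ξ‖ₑ ≤ ∫⁻ x, ‖f x‖ₑ := by
  refine (enorm_integral_le_lintegral_enorm _).trans (le_of_eq (lintegral_congr fun x => ?_))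
  rw [enorm_mul, enorm_exp_neg_inner_mul, one_mul]

lemma integrable_exp_mul {f : EuclideanSpace ℝ (Fin n) → ℂ} (hf : Integrable f)
    (ξ : EuclideanSpace ℝ (Fin n)) :
    Integrable fun x => Complex.exp (((-(2 * Real.pi * (@inner ℝ _ _ x ξ)) : ℝ) : ℂ) *
      Complex.I) * f x := by
  refine hf.bdd_mul (c := 1) ?_ ?_
  · exact (by fun_prop : Continuous fun x : EuclideanSpace ℝ (Fin n) =>
      Complex.exp (((-(2 * Real.pi * (@inner ℝ _ _ x ξ)) : ℝ) : ℂ) *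
      Complex.I)).aestronglyMeasurable
  · exact Filter.Eventually.of_forall fun x => (Complex.norm_exp_ofReal_mul_I _).le

lemma fourierTf_fwdDiff (v : EuclideanSpace ℝ (Fin n)) {F : EuclideanSpace ℝ (Fin n) → ℝ}
    (hF : Integrable F) (ξ : EuclideanSpace ℝ (Fin n)) :
    fourierTf (fun x => ((fwdDiff v F x : ℝ) : ℂ)) ξ =
      (Complex.exp ((2 * Real.pi * (@inner ℝ _ _ v ξ) : ℝ) * Complex.I) - 1) *
        fourierTf (fun x => (F x : ℂ)) ξ := by
  have h1 : Integrable fun x => (F x : ℂ) := hF.ofReal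
  have h2 : Integrable fun x => (F (x + v) : ℂ) := (hF.comp_add_right v).ofReal
  simp only [fourierTf, fwdDiff, Complex.ofReal_sub, mul_sub]
  rw [integral_sub (integrable_exp_mul h2 ξ) (integrable_exp_mul h1 ξ), sub_mul, one_mul]
  congr 1
  rw [← integral_const_mul]
  have := integral_add_right_eq_self (μ := volume)
    (fun x => Complex.exp ((2 * Real.pi * (@inner ℝ _ _ v ξ) : ℝ) * Complex.I) *
      (Complex.exp (((-(2 * Real.pi * (@inner ℝ _ _ x ξ)) : ℝ) : ℂ) * Complex.I) * F x)) v
  rw [← this]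
  refine integral_congr_ae (Filter.Eventually.of_forall fun x => ?_)
  dsimp only
  rw [← mul_assoc, ← Complex.exp_add, inner_add_left]
  congr 2
  push_cast
  ring

lemma one_le_norm_exp_sub_one {y : ℝ} (h1 : 1 / 4 ≤ |y|) (h2 : |y| ≤ 1 / 2) :
    1 ≤ ‖Complex.exp ((2 * Real.pi * y : ℝ) * Complex.I) - 1‖ := by
  have hcos : Real.cos (2 * Real.pi * y) ≤ 0 := by
    rw [← Real.cos_abs, abs_mul, abs_of_pos (by positivity : 0 < 2 * Real.pi)]
    refine Real.cos_nonpos_of_pi_div_two_le_of_le ?_ ?_ <;> nlinarith [Real.pi_pos]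
  refine le_trans ?_ (Complex.abs_re_le_norm _)
  rw [Complex.sub_re, Complex.exp_ofReal_mul_I_re, Complex.one_re, abs_of_nonpos (by linarith)]
  linarith

lemma norm_fourierTf_le_fwdDiff_iter (k : Fin n) (h : ℝ) (m : ℕ)
    {F : EuclideanSpace ℝ (Fin n) → ℝ}
    (hF : Integrable F) {ξ : EuclideanSpace ℝ (Fin n)} (h1 : 1 / 4 ≤ |h * ξ k|)
    (h2 : |h * ξ k| ≤ 1 / 2) :
    ‖fourierTf (fun x => (F x : ℂ)) ξ‖ₑ ≤
      ‖fourierTf (fun x => (((fwdDiff (h • EuclideanSpace.single k (1 : ℝ)))^[m] F x : ℝ) : ℂ)) ξ‖ₑ := by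
  induction m generalizing F with
  | zero => exact le_rfl
  | succ m ih =>
    rw [Function.iterate_succ]
    refine le_trans ?_ (ih (integrable_fwdDiff _ hF))
    rw [fourierTf_fwdDiff _ hF, enorm_mul]
    refine le_mul_of_one_le_left zero_le ?_
    have e : @inner ℝ _ _ (h • EuclideanSpace.single k (1 : ℝ)) ξ = h * ξ k := by
      rw [real_inner_smul_left, EuclideanSpace.inner_single_left]; simp
    rw [e, ← ofReal_norm, ENNReal.one_le_ofReal]
    exact one_le_norm_exp_sub_one h1 h2

lemma enorm_fourierTf_le_tsum {f : EuclideanSpace ℝ (Fin n) → ℂ} (hf : Integrable f)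
    {A : ℤ → Set (EuclideanSpace ℝ (Fin n))} (hA : ∀ k, MeasurableSet (A k))
    (hd : Pairwise (Function.onFun Disjoint A)) (h0 : ∀ᵐ x, (∀ k, x ∉ A k) → f x = 0)
    (ξ : EuclideanSpace ℝ (Fin n)) :
    ‖fourierTf f ξ‖ₑ ≤ ∑' k, ‖fourierTf ((A k).indicator f) ξ‖ₑ := by
  have hs := hasSum_integral_iUnion (μ := volume) hA hd
    (f := fun x => Complex.exp (((-(2 * Real.pi * (@inner ℝ _ _ x ξ)) : ℝ) : ℂ) *
      Complex.I) * f x) (integrable_exp_mul hf ξ).integrableOn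
  rw [setIntegral_eq_integral_of_ae_compl_eq_zero] at hs
  · have e : ∀ k, fourierTf ((A k).indicator f) ξ = ∫ x in A k,
        Complex.exp (((-(2 * Real.pi * (@inner ℝ _ _ x ξ)) : ℝ) : ℂ) * Complex.I) * f x :=
      fun k => by
        rw [← integral_indicator (hA k), fourierTf]
        refine integral_congr_ae (Filter.Eventually.of_forall fun x => ?_)
        by_cases hx : x ∈ A k <;> simp [hx]
    simp only [e]
    rw [fourierTf, ← hs.tsum_eq]
    exact enorm_tsum_le_tsum_enorm
  · filter_upwards [h0] with x hx hn
    rw [hx fun k hk => hn (mem_iUnion.2 ⟨k, hk⟩), mul_zero]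

lemma lintegral_region_le_of_line (k : Fin n) {L : ℝ} {R R' : Set (EuclideanSpace ℝ (Fin n))}
    (hR : MeasurableSet R) (hR' : MeasurableSet R')
    (hsub : ∀ ξ ∈ R, ∀ s ∈ Ioc 0 L, ξ - s • EuclideanSpace.single k (1 : ℝ) ∈ R')
    {F : EuclideanSpace ℝ (Fin n) → ℝ≥0∞} (hF : Measurable F) {B : ℝ≥0∞}
    (hB : ∀ ξ, ∫⁻ s in Ioc 0 L, F (ξ + s • EuclideanSpace.single k (1 : ℝ)) ≤ B) :
    ENNReal.ofReal L * ∫⁻ ξ in R, F ξ ≤ volume R' * B := by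
  calc ENNReal.ofReal L * ∫⁻ ξ in R, F ξ = ∫⁻ s in Ioc 0 L, ∫⁻ ξ, R.indicator F ξ := by
        rw [lintegral_indicator hR]; simp [mul_comm]
    _ = ∫⁻ s in Ioc 0 L, ∫⁻ ξ,
          R.indicator F (ξ + s • EuclideanSpace.single k (1 : ℝ)) := by
        refine lintegral_congr fun s => ?_
        rw [lintegral_add_right_eq_self]
    _ ≤ ∫⁻ s in Ioc 0 L, ∫⁻ ξ,
          R'.indicator (fun ξ => F (ξ + s • EuclideanSpace.single k (1 : ℝ))) ξ := by
        refine setLIntegral_mono' measurableSet_Ioc fun s hs => lintegral_mono fun ξ => ?_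
        by_cases h : ξ + s • EuclideanSpace.single k (1 : ℝ) ∈ R
        · have h' : ξ ∈ R' := by simpa using hsub _ h s hs
          rw [indicator_of_mem h, indicator_of_mem h']
        · rw [indicator_of_notMem h]; exact zero_le
    _ = ∫⁻ s in Ioc 0 L, ∫⁻ ξ in R', F (ξ + s • EuclideanSpace.single k (1 : ℝ)) := by
        simp only [lintegral_indicator hR']
    _ = ∫⁻ ξ in R', ∫⁻ s in Ioc 0 L, F (ξ + s • EuclideanSpace.single k (1 : ℝ)) :=
        lintegral_lintegral_swap (by fun_prop)
    _ ≤ ∫⁻ ξ in R', B := lintegral_mono fun ξ => hB ξ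
    _ = _ := by simp [mul_comm]

open scoped FourierTransform in
/-- Integrating a Fourier transform along a segment in direction `k` only involves the
marginal of the function in that direction. -/
lemma lintegral_segment_fourierTf_le (k : Fin n) {L : ℝ}
    {v : EuclideanSpace ℝ (Fin n) → ℂ} (hv : Integrable v) {Ψ : ℝ → ℝ≥0∞} (hΨ : Measurable Ψ)
    (hm : ∀ θ : ℝ → ℝ≥0∞, Measurable θ → ∫⁻ x, ‖v x‖ₑ * θ (x k) ≤ ∫⁻ t, Ψ t * θ t)
    (ξ : EuclideanSpace ℝ (Fin n)) :
    ∫⁻ s in Ioc 0 L, ‖fourierTf v (ξ + s • EuclideanSpace.single k (1 : ℝ))‖ₑ ≤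
      (ENNReal.ofReal L * ∫⁻ t, Ψ t ^ (2 : ℝ)) ^ (1 / 2 : ℝ) := by
  set w : ℝ → ℂ := fun s => fourierTf v (ξ + s • EuclideanSpace.single k (1 : ℝ)) with hw
  have hwc : Continuous w := (continuous_fourierTf hv).comp (by fun_prop)
  set c : ℝ → ℂ := (Ioc 0 L).indicator fun s => (starRingEnd ℂ) (w s) / (‖w s‖ : ℂ) with hc
  have hcm : Measurable c := by
    refine Measurable.indicator ?_ measurableSet_Ioc
    have := hwc.measurable
    have h2 : Measurable fun s => (starRingEnd ℂ) (w s) := (Complex.continuous_conj.comp hwc).measurable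
    fun_prop
  have hc1 : ∀ s, ‖c s‖ ≤ (Ioc 0 L).indicator (fun _ => (1 : ℝ)) s := fun s => by
    by_cases hs : s ∈ Ioc 0 L
    · simp only [hc, indicator_of_mem hs, norm_div, RCLike.norm_conj, Complex.norm_real, norm_norm]
      exact div_self_le_one _
    · simp [hc, hs]
  have hIi : Integrable ((Ioc 0 L).indicator fun _ : ℝ => (1 : ℝ)) :=
    (integrable_indicator_iff measurableSet_Ioc).2 (integrable_const _)
  have hci : Integrable c :=
    hIi.mono' hcm.aestronglyMeasurable (Filter.Eventually.of_forall hc1)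
  have hc2 : MemLp c 2 := by
    refine MemLp.of_le (g := (Ioc 0 L).indicator fun _ : ℝ => (1 : ℝ)) ?_
      hcm.aestronglyMeasurable (Filter.Eventually.of_forall fun s => ?_)
    · exact memLp_indicator_const _ measurableSet_Ioc _ (Or.inr (by simp))
    · exact (hc1 s).trans (le_abs_self _)
  have hcsq : ∫⁻ s, ‖c s‖ₑ ^ (2 : ℝ) ≤ ENNReal.ofReal L := by
    calc ∫⁻ s, ‖c s‖ₑ ^ (2 : ℝ) ≤ ∫⁻ s, (Ioc 0 L).indicator 1 s := by
          refine lintegral_mono fun s => ?_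
          by_cases hs : s ∈ Ioc 0 L
          · have := hc1 s
            rw [indicator_of_mem hs] at this ⊢
            refine ENNReal.rpow_le_one ?_ (by norm_num)
            rw [← ofReal_norm]
            exact ENNReal.ofReal_le_one.2 this
          · simp [hc, hs]
      _ = _ := by rw [lintegral_indicator_one measurableSet_Ioc]; simp
  have hcw : ∀ s, c s * w s = (((Ioc 0 L).indicator (fun s => ‖w s‖) s : ℝ) : ℂ) := fun s => by
    by_cases hs : s ∈ Ioc 0 L
    · simp only [hc, indicator_of_mem hs]
      rcases eq_or_ne (w s) 0 with h0 | h0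
      · simp [h0]
      · have : (‖w s‖ : ℂ) ≠ 0 := by simpa using h0
        rw [div_mul_eq_mul_div, mul_comm, Complex.mul_conj, div_eq_iff this,
          Complex.normSq_eq_norm_sq]
        push_cast; ring
    · simp [hc, hs]
  have hΘ : Continuous (𝓕 c) := VectorFourier.fourierIntegral_continuous
    Real.continuous_fourierChar (L := innerₗ ℝ) continuous_inner hci
  have e1 : ∫⁻ s in Ioc 0 L, ‖w s‖ₑ = ‖∫ s, c s * w s‖ₑ := by
    simp only [hcw]
    rw [integral_complex_ofReal, integral_indicator measurableSet_Ioc, ← ofReal_norm, Complex.norm_real,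
      Real.norm_of_nonneg (integral_nonneg fun _ => norm_nonneg _),
      ofReal_integral_norm_eq_lintegral_enorm]
    exact (hwc.integrableOn_Icc).mono_set Ioc_subset_Icc_self
  set E : EuclideanSpace ℝ (Fin n) → EuclideanSpace ℝ (Fin n) → ℂ := fun x η =>
    Complex.exp (((-(2 * Real.pi * (@inner ℝ _ _ x η)) : ℝ) : ℂ) * Complex.I) with hE
  have hEn : ∀ x η, ‖E x η‖ = 1 := fun x η => Complex.norm_exp_ofReal_mul_I _
  have hfint : Integrable (fun p : ℝ × EuclideanSpace ℝ (Fin n) =>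
      c p.1 * (E p.2 (ξ + p.1 • EuclideanSpace.single k (1 : ℝ)) * v p.2))
      (volume.prod volume) := by
    have h1 : Integrable (fun p : ℝ × EuclideanSpace ℝ (Fin n) => c p.1 * v p.2)
      (volume.prod volume) := hci.mul_prod hv
    refine (h1.bdd_mul (c := 1) (f := fun p : ℝ × EuclideanSpace ℝ (Fin n) =>
      E p.2 (ξ + p.1 • EuclideanSpace.single k (1 : ℝ))) ?_
      (Filter.Eventually.of_forall fun p => (hEn _ _).le)).congr
      (Filter.Eventually.of_forall fun p => ?_)
    · exact (by simp only [hE]; fun_prop : Continuous _).aestronglyMeasurable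
    · dsimp only; ring
  have e2 : ∫ s, c s * w s = ∫ x, E x ξ * v x * 𝓕 c (x k) := by
    simp only [hw, fourierTf, ← integral_const_mul]
    rw [integral_integral_swap hfint]
    refine integral_congr_ae (Filter.Eventually.of_forall fun x => ?_)
    dsimp only
    rw [Real.fourier_eq', ← integral_const_mul]
    refine integral_congr_ae (Filter.Eventually.of_forall fun s => ?_)
    dsimp only [hE]
    rw [inner_add_right, real_inner_smul_right, EuclideanSpace.inner_single_right, mul_add, neg_add,
      Complex.ofReal_add, add_mul, Complex.exp_add]
    simp only [smul_eq_mul, RCLike.inner_apply, conj_trivial, one_mul]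
    have : (-(2 * Real.pi * (s * x k)) : ℝ) = -2 * Real.pi * (x k * s) := by ring
    rw [this]
    ring
  rw [e1, e2]
  calc ‖∫ x, E x ξ * v x * 𝓕 c (x k)‖ₑ ≤ ∫⁻ x, ‖v x‖ₑ * ‖𝓕 c (x k)‖ₑ := by
        refine (enorm_integral_le_lintegral_enorm _).trans (lintegral_mono fun x => ?_)
        rw [enorm_mul, enorm_mul, ← ofReal_norm (E x ξ), hEn]; simp
    _ ≤ ∫⁻ t, Ψ t * ‖𝓕 c t‖ₑ := hm (fun t => ‖𝓕 c t‖ₑ) hΘ.measurable.enorm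
    _ ≤ (∫⁻ t, Ψ t ^ (2 : ℝ)) ^ (1 / 2 : ℝ) * (∫⁻ t, ‖𝓕 c t‖ₑ ^ (2 : ℝ)) ^ (1 / 2 : ℝ) :=
        ENNReal.lintegral_mul_le_Lp_mul_Lq volume Real.HolderConjugate.two_two hΨ.aemeasurable
          hΘ.measurable.enorm.aemeasurable
    _ ≤ (∫⁻ t, Ψ t ^ (2 : ℝ)) ^ (1 / 2 : ℝ) * ENNReal.ofReal L ^ (1 / 2 : ℝ) := by
        rw [lintegral_enorm_fourier_sq hci hc2]
        gcongr
    _ = _ := by rw [mul_comm, ENNReal.mul_rpow_of_nonneg _ _ (by norm_num)]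

lemma lintegral_region_fourierTf_le {k : Fin n} {l : ℝ} {a : ℤ} {v : EuclideanSpace ℝ (Fin n) → ℂ}
    (hv : Integrable v) {B : Set ℝ} (hB : MeasurableSet B) {D : ℝ≥0∞} {N : ℕ} (hN : 1 ≤ N)
    (hvol : volume B ≤ N * twoPow (-l))
    (hm : ∀ θ : ℝ → ℝ≥0∞, Measurable θ →
      ∫⁻ x, ‖v x‖ₑ * θ (x k) ≤ ∫⁻ t, B.indicator (fun _ => D) t * θ t)
    {R R' : Set (EuclideanSpace ℝ (Fin n))} (hR : MeasurableSet R) (hR' : MeasurableSet R')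
    (hRR' : R ⊆ R')
    (hsub : ∀ ξ ∈ R, ∀ s ∈ Ioc (0 : ℝ) (2 ^ (a : ℝ)),
      ξ - s • EuclideanSpace.single k (1 : ℝ) ∈ R') :
    ∫⁻ ξ in R, ‖fourierTf v ξ‖ₑ ≤
      volume R' * (D * N * twoPow (-l) * min 1 (twoPow ((l - a) / 2))) := by
  have hS : ∫⁻ ξ in R, ‖fourierTf v ξ‖ₑ ≤ volume R' * (D * N * twoPow (-l)) := by
    calc ∫⁻ ξ in R, ‖fourierTf v ξ‖ₑ ≤ ∫⁻ ξ in R, ∫⁻ x, ‖v x‖ₑ :=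
          lintegral_mono fun ξ => enorm_fourierTf_le v ξ
      _ = volume R * ∫⁻ x, ‖v x‖ₑ := by simp [mul_comm]
      _ ≤ volume R' * (D * (N * twoPow (-l))) := by
          refine mul_le_mul' (measure_mono hRR') ?_
          refine le_trans ?_ (mul_le_mul' le_rfl hvol)
          simpa [lintegral_indicator hB] using hm 1 measurable_one
      _ = _ := by ring
  have hP : ∫⁻ ξ in R, ‖fourierTf v ξ‖ₑ ≤
      volume R' * (D * N * twoPow (-l) * twoPow ((l - a) / 2)) := by
    have h1 := lintegral_region_le_of_line k hR hR' hsub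
      (continuous_fourierTf hv).measurable.enorm
      (lintegral_segment_fourierTf_le k (L := 2 ^ (a : ℝ)) hv
        (measurable_const.indicator hB) hm)
    have h2 : ∫⁻ t, B.indicator (fun _ => D) t ^ (2 : ℝ) ≤ D ^ (2 : ℝ) * (N * twoPow (-l)) := by
      have : ∀ t, B.indicator (fun _ => D) t ^ (2 : ℝ) = B.indicator (fun _ => D ^ (2 : ℝ)) t :=
        fun t => by by_cases ht : t ∈ B <;> simp [ht]
      simp only [this]
      rw [lintegral_indicator_const hB]
      gcongr
    have h3 : (ENNReal.ofReal (2 ^ (a : ℝ)) * ∫⁻ t, B.indicator (fun _ => D) t ^ (2 : ℝ)) ^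
        (1 / 2 : ℝ) ≤ D * N * twoPow ((a - l) / 2) := by
      calc _ ≤ (twoPow a * (D ^ (2 : ℝ) * (N * twoPow (-l)))) ^ (1 / 2 : ℝ) := by
            rw [twoPow_eq_ofReal a]; gcongr
        _ = D * (N : ℝ≥0∞) ^ (1 / 2 : ℝ) * twoPow ((a - l) / 2) := by
            have e1 : twoPow ((a - l) / 2) = (twoPow a * twoPow (-l)) ^ (1 / 2 : ℝ) := by
              rw [← twoPow_add, ← twoPow_mul]; congr 1; ring
            rw [e1]
            rw [ENNReal.mul_rpow_of_nonneg _ _ (by norm_num : (0 : ℝ) ≤ 1 / 2),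
              ENNReal.mul_rpow_of_nonneg _ _ (by norm_num : (0 : ℝ) ≤ 1 / 2),
              ENNReal.mul_rpow_of_nonneg _ _ (by norm_num : (0 : ℝ) ≤ 1 / 2),
              ENNReal.mul_rpow_of_nonneg _ _ (by norm_num : (0 : ℝ) ≤ 1 / 2),
              ← ENNReal.rpow_mul]
            norm_num
            ring
        _ ≤ _ := by
            gcongr
            calc (N : ℝ≥0∞) ^ (1 / 2 : ℝ) ≤ (N : ℝ≥0∞) ^ (1 : ℝ) :=
                  ENNReal.rpow_le_rpow_of_exponent_le (by exact_mod_cast hN) (by norm_num)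
              _ = N := ENNReal.rpow_one _
    calc ∫⁻ ξ in R, ‖fourierTf v ξ‖ₑ
        = twoPow (-a) * (twoPow a * ∫⁻ ξ in R, ‖fourierTf v ξ‖ₑ) := by
          rw [← mul_assoc, ← twoPow_add]; simp
      _ ≤ twoPow (-a) * (volume R' * (D * N * twoPow ((a - l) / 2))) := by
          refine mul_le_mul' le_rfl ?_
          rw [twoPow_eq_ofReal a]
          exact h1.trans (mul_le_mul' le_rfl h3)
      _ = volume R' * (D * N * (twoPow (-a) * twoPow ((a - l) / 2))) := by ring
      _ = _ := by
          have e : -(a : ℝ) + (a - l) / 2 = -l + (l - a) / 2 := by ring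
          rw [mul_assoc (D * N), ← twoPow_add, ← twoPow_add, e]
  rcases le_total 1 (twoPow ((l - a) / 2)) with h | h
  · rwa [min_eq_left h, mul_one]
  · rwa [min_eq_right h]

lemma marginal_indicator_le {q : Fin n} {U : EuclideanSpace ℝ (Fin n) → ℂ} {κ : ℝ≥0∞}
    {β : ℝ → ℝ≥0∞}
    (hM : ∀ θ : ℝ → ℝ≥0∞, Measurable θ → ∫⁻ x, ‖U x‖ₑ * θ (x q) ≤ κ * ∫⁻ t, β t * θ t)
    {A : Set ℝ} (hA : MeasurableSet A) {c : ℝ≥0∞} (hc : ∀ t ∈ A, β t ≤ c)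
    {θ : ℝ → ℝ≥0∞} (hθ : Measurable θ) :
    ∫⁻ x, ‖{x : EuclideanSpace ℝ (Fin n) | x q ∈ A}.indicator U x‖ₑ * θ (x q) ≤
      ∫⁻ t, A.indicator (fun _ => κ * c) t * θ t := by
  calc _ = ∫⁻ x, ‖U x‖ₑ * A.indicator θ (x q) := by
        refine lintegral_congr fun x => ?_
        by_cases hx : x q ∈ A <;> simp [hx]
    _ ≤ κ * ∫⁻ t, β t * A.indicator θ t := hM _ (hθ.indicator hA)
    _ ≤ κ * ∫⁻ t, A.indicator (fun _ => c) t * θ t := by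
        refine mul_le_mul' le_rfl (lintegral_mono fun t => ?_)
        by_cases ht : t ∈ A
        · simp only [indicator_of_mem ht]; exact mul_le_mul' (hc t ht) le_rfl
        · simp [ht]
    _ = _ := by
        have hmm : Measurable fun t => A.indicator (fun _ => c) t * θ t :=
          (measurable_const.indicator hA).mul hθ
        rw [← lintegral_const_mul _ hmm]
        refine lintegral_congr fun t => ?_
        by_cases ht : t ∈ A <;> simp [ht, mul_assoc]

lemma marginal_indicator_inter_le {p q : Fin n} {U : EuclideanSpace ℝ (Fin n) → ℂ} {κ : ℝ≥0∞}
    {β : ℝ → ℝ≥0∞}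
    (hM : ∀ θ τ : ℝ → ℝ≥0∞, Measurable θ → Measurable τ →
      ∫⁻ x, ‖U x‖ₑ * (τ (x p) * θ (x q)) ≤ κ * (∫⁻ t, θ t) * ∫⁻ t, β t * τ t)
    {A B : Set ℝ} (hA : MeasurableSet A) (hB : MeasurableSet B) {c : ℝ≥0∞}
    (hc : ∀ t ∈ B, β t ≤ c) {τ : ℝ → ℝ≥0∞} (hτ : Measurable τ) :
    ∫⁻ x, ‖{x : EuclideanSpace ℝ (Fin n) | x q ∈ A ∧ x p ∈ B}.indicator U x‖ₑ * τ (x p) ≤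
      ∫⁻ t, B.indicator (fun _ => κ * volume A * c) t * τ t := by
  have hmp : Measurable fun x : EuclideanSpace ℝ (Fin n) => x q := by fun_prop
  have h1 := marginal_indicator_le (q := p)
    (U := {x : EuclideanSpace ℝ (Fin n) | x q ∈ A}.indicator U) (κ := κ * volume A) (β := β)
    (fun τ hτ => by
      have := hM (A.indicator 1) τ (measurable_one.indicator hA) hτ
      rw [lintegral_indicator_one hA] at this
      refine le_trans (le_of_eq (lintegral_congr fun x => ?_)) this
      by_cases hx : x q ∈ A <;> simp [hx]) hB hc hτ
  refine le_trans (le_of_eq (lintegral_congr fun x => ?_)) h1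
  by_cases hx : x q ∈ A <;> by_cases hy : x p ∈ B <;> simp [hx, hy]

lemma ae_eq_zero_of_marginal_le {q : Fin n} {U : EuclideanSpace ℝ (Fin n) → ℂ}
    (hU : Integrable U) {κ : ℝ≥0∞} {β : ℝ → ℝ≥0∞}
    (hM : ∀ θ : ℝ → ℝ≥0∞, Measurable θ → ∫⁻ x, ‖U x‖ₑ * θ (x q) ≤ κ * ∫⁻ t, β t * θ t)
    {A : ℤ → Set ℝ} (hA : ∀ k, MeasurableSet (A k)) (h0 : ∀ᵐ t, (∀ k, t ∉ A k) → β t = 0) :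
    ∀ᵐ x : EuclideanSpace ℝ (Fin n), (∀ k, x q ∉ A k) → U x = 0 := by
  have hm : MeasurableSet (⋃ k, A k)ᶜ := (MeasurableSet.iUnion hA).compl
  have hmq : Measurable fun x : EuclideanSpace ℝ (Fin n) => x q := by fun_prop
  have h1 : ∫⁻ x, ‖U x‖ₑ * (⋃ k, A k)ᶜ.indicator 1 (x q) ≤ 0 := by
    refine (hM _ (measurable_one.indicator hm)).trans (le_of_eq ?_)
    rw [mul_eq_zero]; right
    rw [lintegral_congr_ae (g := 0)]
    · simp
    · filter_upwards [h0] with t ht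
      by_cases h : t ∈ ⋃ k, A k
      · have h' : t ∉ (⋃ k, A k)ᶜ := fun h' => h' h
        simp only [indicator_of_notMem h', mul_zero, Pi.zero_apply]
      · rw [ht (by simpa using h)]; simp
  have h2 := (lintegral_eq_zero_iff' (hU.aestronglyMeasurable.enorm.mul
    ((measurable_one.indicator hm).comp hmq).aemeasurable)).1 (le_antisymm h1 zero_le)
  filter_upwards [h2] with x hx hk
  have : x q ∈ (⋃ k, A k)ᶜ := by simpa using hk
  simp only [Pi.mul_apply, Function.comp_apply, indicator_of_mem this, Pi.one_apply, mul_one,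
    Pi.zero_apply] at hx
  exact enorm_eq_zero.1 hx

lemma exponent_bound_low {ε M d P : ℝ} (hε : 0 < ε) (hP : 0 ≤ P) (hd : d ≤ M) (hd0 : 0 ≤ d) : -(2 * ε * M) ≤ 2 * P + -(ε * |M|) + -(ε * |d|) := by
  rw [abs_of_nonneg hd0, abs_of_nonneg (hd0.trans hd)]; nlinarith

lemma exponent_bound_neg {ε M d P : ℝ} (hε : 0 < ε) (hε' : ε ≤ 1 / 2) (hP : 0 ≤ P) (hM : -P ≤ M)
    (hd0 : d ≤ 0) : -(2 * ε * M) + d / 2 ≤ 2 * P + -(ε * |M|) + -(ε * |d|) := by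
  rw [abs_of_nonpos hd0]
  rcases abs_cases M with h | h <;> rw [h.1] <;> nlinarith

lemma exponent_bound {ε M P : ℝ} (hε : 0 < ε) (hε' : ε ≤ 1 / 2) (hP : 0 ≤ P) (hM : -P ≤ M) :
    -(2 * ε * M) ≤ 2 * P + -(ε * |M|) := by
  rcases abs_cases M with h | h <;> rw [h.1] <;> nlinarith

/-- The contribution of one spectral box to the weighted Fourier integral. -/
lemma lintegral_box_fourierTf_le {p q : Fin n} {U : EuclideanSpace ℝ (Fin n) → ℂ}
    (hU : Integrable U) {β₁ β₂ : ℝ → ℝ≥0∞} {A B : ℤ → Set ℝ}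
    (hA : ∀ k, MeasurableSet (A k)) (hB : ∀ l, MeasurableSet (B l))
    (hAd : Pairwise (Function.onFun Disjoint A)) (hBd : Pairwise (Function.onFun Disjoint B))
    {NA NB : ℕ} (hNA : 1 ≤ NA) (hNB : 1 ≤ NB)
    (hAv : ∀ k, volume (A k) ≤ NA * twoPow (-k)) (hBv : ∀ l, volume (B l) ≤ NB * twoPow (-l))
    {c₁ c₂ : ℤ → ℝ≥0∞} (hc₁ : ∀ k, ∀ t ∈ A k, β₁ t ≤ c₁ k) (hc₂ : ∀ l, ∀ t ∈ B l, β₂ t ≤ c₂ l)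
    (h01 : ∀ᵐ t, (∀ k, t ∉ A k) → β₁ t = 0) (h02 : ∀ᵐ t, (∀ l, t ∉ B l) → β₂ t = 0)
    {P Q a b m : ℤ} (hP : 0 ≤ P) (hm : m = P * a - Q * b) (hmP : -P ≤ m)
    {κ : ℝ≥0∞}
    (hM₁ : ∀ θ : ℝ → ℝ≥0∞, Measurable θ →
      ∫⁻ x, ‖U x‖ₑ * θ (x q) ≤ twoPow (-(P * a)) * ∫⁻ t, β₁ t * θ t)
    (hM₂ : ∀ θ : ℝ → ℝ≥0∞, Measurable θ → ∫⁻ x, ‖U x‖ₑ * θ (x p) ≤ κ * ∫⁻ t, β₂ t * θ t)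
    (hM₃ : ∀ θ τ : ℝ → ℝ≥0∞, Measurable θ → Measurable τ →
      ∫⁻ x, ‖U x‖ₑ * (τ (x p) * θ (x q)) ≤
        twoPow (-((Q - 1) * b)) * (∫⁻ t, θ t) * ∫⁻ t, β₂ t * τ t)
    (hM₄ : ∀ τ θ : ℝ → ℝ≥0∞, Measurable τ → Measurable θ →
      ∫⁻ x, ‖U x‖ₑ * (θ (x q) * τ (x p)) ≤
        twoPow (-((P - 1) * a)) * (∫⁻ t, τ t) * ∫⁻ t, β₁ t * θ t)
    {R R' : Set (EuclideanSpace ℝ (Fin n))} (hR : MeasurableSet R) (hR' : MeasurableSet R')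
    (hRR' : R ⊆ R')
    (hp : ∀ ξ ∈ R, ∀ s ∈ Ioc (0 : ℝ) (2 ^ (a : ℝ)),
      ξ - s • EuclideanSpace.single p (1 : ℝ) ∈ R')
    (hq : ∀ ξ ∈ R, ∀ s ∈ Ioc (0 : ℝ) (2 ^ (b : ℝ)),
      ξ - s • EuclideanSpace.single q (1 : ℝ) ∈ R')
    {ε : ℝ} (hε : 0 < ε) (hε' : ε ≤ 1 / 2) {W C : ℝ≥0∞}
    (hW : W * volume R' ≤ C * twoPow (P * a - 2 * ε * m)) :
    W * ∫⁻ ξ in R, ‖fourierTf U ξ‖ₑ ≤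
      C * NA * NB * twoPow (2 * P) * (twoPow (-(ε * |(m : ℝ)|)) *
        (∑' k : ℤ, twoPow (-(ε * |(k : ℝ) - b|)) * (twoPow (-k) * c₁ k) +
          geomSum (1 / 2) * (∑' k : ℤ, twoPow (-(1 / 2 * |(k : ℝ) - (b + m : ℤ)|)) *
            (twoPow (-k) * c₁ k)) +
          geomSum (1 / 2) * (∑' l : ℤ, twoPow (-(1 / 2 * |(l : ℝ) - a|)) *
            (twoPow (-l) * c₂ l)))) := by
  have hmq : Measurable fun x : EuclideanSpace ℝ (Fin n) => x q := by fun_prop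
  have hmp : Measurable fun x : EuclideanSpace ℝ (Fin n) => x p := by fun_prop
  have hPR : (0 : ℝ) ≤ P := by exact_mod_cast hP
  have hmPR : -(P : ℝ) ≤ m := by exact_mod_cast hmP
  have hmR : (m : ℝ) = P * a - Q * b := by rw [hm]; push_cast; ring
  have hNA' : (1 : ℝ≥0∞) ≤ NA := by exact_mod_cast hNA
  have hNB' : (1 : ℝ≥0∞) ≤ NB := by exact_mod_cast hNB
  set UA : ℤ → EuclideanSpace ℝ (Fin n) → ℂ := fun k => {x | x q ∈ A k}.indicator U with hUA
  set UAB : ℤ → ℤ → EuclideanSpace ℝ (Fin n) → ℂ :=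
    fun k l => {x | x q ∈ A k ∧ x p ∈ B l}.indicator U with hUAB
  have hUAi : ∀ k, Integrable (UA k) := fun k => hU.indicator (hmq (hA k))
  have hUABi : ∀ k l, Integrable (UAB k l) := fun k l =>
    hU.indicator ((hmq (hA k)).inter (hmp (hB l)))
  -- low levels in the first variable
  have hlow : ∀ k : ℤ, k ≤ b + m → W * ∫⁻ ξ in R, ‖fourierTf (UA k) ξ‖ₑ ≤
      C * NA * NB * twoPow (2 * P) * (twoPow (-(ε * |(m : ℝ)|)) *
        (twoPow (-(ε * |(k : ℝ) - b|)) * (twoPow (-k) * c₁ k))) := fun k hk => by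
    have hkR : (k : ℝ) - b ≤ m := by
      have : (k : ℝ) ≤ b + m := by exact_mod_cast hk
      linarith
    have h1 := lintegral_region_fourierTf_le (hUAi k) (hA k) hNA (hAv k)
      (fun θ hθ => marginal_indicator_le hM₁ (hA k) (hc₁ k) hθ) hR hR' hRR' hq
    have h2 : twoPow (-(2 * ε * m)) * min 1 (twoPow ((k - b) / 2)) ≤
        twoPow (2 * P) * twoPow (-(ε * |(m : ℝ)|)) * twoPow (-(ε * |(k : ℝ) - b|)) := by
      rw [← twoPow_add, ← twoPow_add]
      rcases le_total 0 ((k : ℝ) - b) with h | h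
      · refine (mul_le_mul' le_rfl (min_le_left _ _)).trans ?_
        rw [mul_one]
        exact twoPow_mono (exponent_bound_low hε hPR hkR h)
      · refine (mul_le_mul' le_rfl (min_le_right _ _)).trans ?_
        rw [← twoPow_add]
        exact twoPow_mono (exponent_bound_neg hε hε' hPR hmPR h)
    have e : twoPow (P * a - 2 * ε * m) * twoPow (-(P * a)) = twoPow (-(2 * ε * m)) := by
      rw [← twoPow_add]; congr 1; ring
    calc _ ≤ W * _ := mul_le_mul' le_rfl h1
      _ = W * volume R' * (twoPow (-(P * a)) * c₁ k * NA * twoPow (-k) *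
            min 1 (twoPow ((k - b) / 2))) := by ring
      _ ≤ C * twoPow (P * a - 2 * ε * m) * (twoPow (-(P * a)) * c₁ k * NA * twoPow (-k) *
            min 1 (twoPow ((k - b) / 2))) := mul_le_mul' hW le_rfl
      _ = C * NA * (twoPow (-k) * c₁ k) * (twoPow (P * a - 2 * ε * m) * twoPow (-(P * a)) *
            min 1 (twoPow ((k - b) / 2))) := by ring
      _ ≤ C * NA * (twoPow (-k) * c₁ k) *
            (twoPow (2 * P) * twoPow (-(ε * |(m : ℝ)|)) * twoPow (-(ε * |(k : ℝ) - b|))) := by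
          rw [e]; exact mul_le_mul' le_rfl h2
      _ = C * NA * 1 * twoPow (2 * P) * (twoPow (-(ε * |(m : ℝ)|)) *
        (twoPow (-(ε * |(k : ℝ) - b|)) * (twoPow (-k) * c₁ k))) := by ring
      _ ≤ _ := by gcongr
  -- high levels in the first variable, split along the second one
  have hhigh : ∀ k : ℤ, b + m ≤ k → ∀ l : ℤ, W * ∫⁻ ξ in R, ‖fourierTf (UAB k l) ξ‖ₑ ≤
      C * NA * NB * twoPow (2 * P) * (twoPow (-(ε * |(m : ℝ)|)) *
        (twoPow (-(1 / 2 * |(k : ℝ) - (b + m : ℤ)|)) * twoPow (-(1 / 2 * |(l : ℝ) - a|)) *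
          (twoPow (-k) * c₁ k + twoPow (-l) * c₂ l))) := fun k hk l => by
    have hkR : (0 : ℝ) ≤ k - (b + m) := by
      have : (b : ℝ) + m ≤ k := by exact_mod_cast hk
      linarith
    have habs : |(k : ℝ) - (b + m : ℤ)| = k - (b + m) := by
      push_cast; exact abs_of_nonneg hkR
    have hexp := exponent_bound hε hε' hPR hmPR
    have finish : ∀ (X z : ℝ≥0∞) (s : ℝ), X ≤ C * NA * NB * z * (twoPow (-(2 * ε * m)) * twoPow s) →
        z ≤ twoPow (-k) * c₁ k + twoPow (-l) * c₂ l →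
        s ≤ -(1 / 2 * |(k : ℝ) - (b + m : ℤ)|) + -(1 / 2 * |(l : ℝ) - a|) →
        X ≤ C * NA * NB * twoPow (2 * P) * (twoPow (-(ε * |(m : ℝ)|)) *
        (twoPow (-(1 / 2 * |(k : ℝ) - (b + m : ℤ)|)) * twoPow (-(1 / 2 * |(l : ℝ) - a|)) *
          (twoPow (-k) * c₁ k + twoPow (-l) * c₂ l))) := fun X z s hX hz hs => by
      calc X ≤ _ := hX
        _ ≤ C * NA * NB * (twoPow (-k) * c₁ k + twoPow (-l) * c₂ l) *
            (twoPow (2 * P + -(ε * |(m : ℝ)|)) *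
            twoPow (-(1 / 2 * |(k : ℝ) - (b + m : ℤ)|) + -(1 / 2 * |(l : ℝ) - a|))) :=
          mul_le_mul' (mul_le_mul' le_rfl hz) (mul_le_mul' (twoPow_mono hexp) (twoPow_mono hs))
        _ = _ := by rw [twoPow_add, twoPow_add]; ring
    have h3 := lintegral_region_fourierTf_le (hUABi k l) (hB l) hNB (hBv l)
      (fun θ hθ => marginal_indicator_inter_le hM₃ (hA k) (hB l) (hc₂ l) hθ) hR hR' hRR' hp
    have hswap : UAB k l = {x | x p ∈ B l ∧ x q ∈ A k}.indicator U := by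
      simp only [hUAB, and_comm]
    have h4 := lintegral_region_fourierTf_le (hUABi k l) (hA k) hNA (hAv k)
      (fun θ hθ => hswap ▸ marginal_indicator_inter_le hM₄ (hB l) (hA k) (hc₁ k) hθ)
      hR hR' hRR' hq
    have e3 : twoPow (P * a - 2 * ε * m) * twoPow (-((Q - 1) * b)) * twoPow (-k) =
        twoPow (-(2 * ε * m)) * twoPow ((b + m) - k) := by
      rw [← twoPow_add, ← twoPow_add, ← twoPow_add]; congr 1; rw [hmR]; ring
    have e4 : twoPow (P * a - 2 * ε * m) * twoPow (-((P - 1) * a)) * twoPow (-l) =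
        twoPow (-(2 * ε * m)) * twoPow (a - l) := by
      rw [← twoPow_add, ← twoPow_add, ← twoPow_add]; congr 1; ring
    have h3' : W * ∫⁻ ξ in R, ‖fourierTf (UAB k l) ξ‖ₑ ≤ C * NA * NB * (twoPow (-l) * c₂ l) *
        (twoPow (-(2 * ε * m)) * (twoPow ((b + m) - k) * min 1 (twoPow ((l - a) / 2)))) := by
      calc _ ≤ W * _ := mul_le_mul' le_rfl h3
        _ = W * volume R' * (twoPow (-((Q - 1) * b)) * volume (A k) * c₂ l * NB * twoPow (-l) *
              min 1 (twoPow ((l - a) / 2))) := by ring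
        _ ≤ C * twoPow (P * a - 2 * ε * m) * (twoPow (-((Q - 1) * b)) * (NA * twoPow (-k)) * c₂ l *
              NB * twoPow (-l) * min 1 (twoPow ((l - a) / 2))) := by
            refine mul_le_mul' hW ?_
            gcongr
            exact hAv k
        _ = C * NA * NB * (twoPow (-l) * c₂ l) * (twoPow (P * a - 2 * ε * m) *
              twoPow (-((Q - 1) * b)) * twoPow (-k) * min 1 (twoPow ((l - a) / 2))) := by ring
        _ = _ := by rw [e3]; ring
    have h4' : W * ∫⁻ ξ in R, ‖fourierTf (UAB k l) ξ‖ₑ ≤ C * NA * NB * (twoPow (-k) * c₁ k) *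
        (twoPow (-(2 * ε * m)) * twoPow (a - l)) := by
      calc _ ≤ W * _ := mul_le_mul' le_rfl h4
        _ = W * volume R' * (twoPow (-((P - 1) * a)) * volume (B l) * c₁ k * NA * twoPow (-k) *
              min 1 (twoPow ((k - b) / 2))) := by ring
        _ ≤ C * twoPow (P * a - 2 * ε * m) * (twoPow (-((P - 1) * a)) * (NB * twoPow (-l)) * c₁ k *
              NA * twoPow (-k) * 1) := by
            refine mul_le_mul' hW ?_
            gcongr
            · exact hBv l
            · exact min_le_left _ _
        _ = C * NA * NB * (twoPow (-k) * c₁ k) * (twoPow (P * a - 2 * ε * m) *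
              twoPow (-((P - 1) * a)) * twoPow (-l)) := by ring
        _ = _ := by rw [e4]
    rcases le_total (l : ℝ) a with h | h
    · refine finish _ _ ((b + m - k) + (l - a) / 2) (h3'.trans ?_) le_add_self ?_
      · rw [twoPow_add]
        refine mul_le_mul' le_rfl (mul_le_mul' le_rfl (mul_le_mul' le_rfl (min_le_right _ _)))
      · rw [habs, abs_of_nonpos (by linarith)]; linarith
    · rcases le_total ((l : ℝ) - a) (k - (b + m)) with h' | h'
      · refine finish _ _ (b + m - k) (h3'.trans ?_) le_add_self ?_
        · refine mul_le_mul' le_rfl (mul_le_mul' le_rfl ?_)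
          exact (mul_le_mul' le_rfl (min_le_left _ _)).trans_eq (mul_one _)
        · rw [habs, abs_of_nonneg (by linarith)]; linarith
      · refine finish _ _ (a - l) h4' le_self_add ?_
        rw [habs, abs_of_nonneg (by linarith)]; linarith
  have hsplit : ∀ k, ∀ ξ, ‖fourierTf (UA k) ξ‖ₑ ≤ ∑' l, ‖fourierTf (UAB k l) ξ‖ₑ := fun k ξ => by
    have h := enorm_fourierTf_le_tsum (hUAi k) (A := fun l => {x | x p ∈ B l})
      (fun l => hmp (hB l)) (fun i j hij => by
        have := hBd hij
        exact Disjoint.preimage _ this) (by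
        filter_upwards [ae_eq_zero_of_marginal_le hU hM₂ hB h02] with x hx hl
        exact indicator_apply_eq_zero.2 fun _ => hx hl) ξ
    refine h.trans_eq (tsum_congr fun l => ?_)
    congr 2
    ext x
    by_cases h1 : x q ∈ A k <;> by_cases h2 : x p ∈ B l <;> simp [hUA, hUAB, h1, h2]
  have hmeas : ∀ V : EuclideanSpace ℝ (Fin n) → ℂ, Integrable V →
      AEMeasurable (fun ξ => ‖fourierTf V ξ‖ₑ) (volume.restrict R) := fun V hV =>
    (continuous_fourierTf hV).measurable.enorm.aemeasurable
  have hall : ∀ k : ℤ, W * ∫⁻ ξ in R, ‖fourierTf (UA k) ξ‖ₑ ≤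
      C * NA * NB * twoPow (2 * P) * (twoPow (-(ε * |(m : ℝ)|)) *
        (twoPow (-(ε * |(k : ℝ) - b|)) * (twoPow (-k) * c₁ k) +
          ∑' l : ℤ, twoPow (-(1 / 2 * |(k : ℝ) - (b + m : ℤ)|)) *
            twoPow (-(1 / 2 * |(l : ℝ) - a|)) *
            (twoPow (-k) * c₁ k + twoPow (-l) * c₂ l))) := fun k => by
    rcases le_total k (b + m) with hk | hk
    · refine (hlow k hk).trans ?_
      exact mul_le_mul' le_rfl (mul_le_mul' le_rfl le_self_add)
    · calc _ ≤ W * ∫⁻ ξ in R, ∑' l, ‖fourierTf (UAB k l) ξ‖ₑ :=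
            mul_le_mul' le_rfl (lintegral_mono fun ξ => hsplit k ξ)
        _ = ∑' l, W * ∫⁻ ξ in R, ‖fourierTf (UAB k l) ξ‖ₑ := by
            rw [lintegral_tsum fun l => hmeas _ (hUABi k l), ENNReal.tsum_mul_left]
        _ ≤ _ := ENNReal.tsum_le_tsum fun l => hhigh k hk l
        _ = C * NA * NB * twoPow (2 * P) * (twoPow (-(ε * |(m : ℝ)|)) *
            ∑' l : ℤ, twoPow (-(1 / 2 * |(k : ℝ) - (b + m : ℤ)|)) *
            twoPow (-(1 / 2 * |(l : ℝ) - a|)) *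
            (twoPow (-k) * c₁ k + twoPow (-l) * c₂ l)) := by
            rw [ENNReal.tsum_mul_left, ENNReal.tsum_mul_left]
        _ ≤ _ := mul_le_mul' le_rfl (mul_le_mul' le_rfl le_add_self)
  have hsplit₀ : ∀ ξ, ‖fourierTf U ξ‖ₑ ≤ ∑' k, ‖fourierTf (UA k) ξ‖ₑ := fun ξ =>
    enorm_fourierTf_le_tsum hU (A := fun k => {x | x q ∈ A k})
      (fun k => hmq (hA k)) (fun i j hij => Disjoint.preimage _ (hAd hij))
      (ae_eq_zero_of_marginal_le hU hM₁ hA h01) ξ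
  calc _ ≤ W * ∫⁻ ξ in R, ∑' k, ‖fourierTf (UA k) ξ‖ₑ :=
        mul_le_mul' le_rfl (lintegral_mono fun ξ => hsplit₀ ξ)
    _ = ∑' k, W * ∫⁻ ξ in R, ‖fourierTf (UA k) ξ‖ₑ := by
        rw [lintegral_tsum fun k => hmeas _ (hUAi k), ENNReal.tsum_mul_left]
    _ ≤ _ := ENNReal.tsum_le_tsum hall
    _ = _ := by
        rw [ENNReal.tsum_mul_left, ENNReal.tsum_mul_left, ENNReal.tsum_add, add_assoc]
        congr 3
        simp only [mul_add, ENNReal.tsum_add]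
        congr 1
        · simp only [mul_assoc, mul_comm _ (twoPow _ * c₁ _), ENNReal.tsum_mul_left,
            ← tsum_twoPow_sub (1 / 2) a]
          simp only [← mul_assoc, mul_comm, ENNReal.tsum_mul_right]
        · rw [← tsum_twoPow_sub (1 / 2) (b + m), ← ENNReal.tsum_mul_right]
          refine tsum_congr fun k => ?_
          simp only [mul_assoc, ENNReal.tsum_mul_left]

lemma tsum_tsum_twoPow_sub_mul (δ : ℝ) (x : ℤ → ℝ≥0∞) :
    ∑' j : ℤ, ∑' k : ℤ, twoPow (-(δ * |(k : ℝ) - j|)) * x k = geomSum δ * ∑' k, x k := by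
  rw [ENNReal.tsum_comm]
  simp only [ENNReal.tsum_mul_right, tsum_twoPow_sub', ENNReal.tsum_mul_left]

lemma tsum_twoPow_comp_le {j : ℤ → ℤ} (hj : Function.Injective j) (δ : ℝ) :
    ∑' a : ℤ, twoPow (-(δ * |(j a : ℝ)|)) ≤ geomSum δ :=
  ENNReal.tsum_comp_le_tsum_of_injective hj fun k : ℤ => twoPow (-(δ * |(k : ℝ)|))

lemma tsum_tsum_box_le {P Q : ℤ} (hP : P ≠ 0) (hQ : Q ≠ 0) (ε : ℝ) (x y : ℤ → ℝ≥0∞) :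
    ∑' a : ℤ, ∑' b : ℤ, twoPow (-(ε * |((P * a - Q * b : ℤ) : ℝ)|)) *
        (∑' k : ℤ, twoPow (-(ε * |(k : ℝ) - b|)) * x k +
          geomSum (1 / 2) * (∑' k : ℤ,
            twoPow (-(1 / 2 * |(k : ℝ) - (b + (P * a - Q * b) : ℤ)|)) * x k) +
          geomSum (1 / 2) * (∑' l : ℤ, twoPow (-(1 / 2 * |(l : ℝ) - a|)) * y l)) ≤
      geomSum ε * (geomSum ε + geomSum (1 / 2) * geomSum (1 / 2)) *
        (∑' k, x k + ∑' l, y l) := by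
  have ha : ∀ b, Function.Injective fun a : ℤ => P * a - Q * b := fun b a a' h => by
    simpa [hP] using h
  have hb : ∀ a, Function.Injective fun b : ℤ => P * a - Q * b := fun a b b' h => by
    simpa [hQ] using h
  have h1 : ∑' a : ℤ, ∑' b : ℤ, twoPow (-(ε * |((P * a - Q * b : ℤ) : ℝ)|)) *
      ∑' k : ℤ, twoPow (-(ε * |(k : ℝ) - b|)) * x k ≤ geomSum ε * (geomSum ε * ∑' k, x k) := by
    rw [ENNReal.tsum_comm, ← tsum_tsum_twoPow_sub_mul, ← ENNReal.tsum_mul_left]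
    refine ENNReal.tsum_le_tsum fun b => ?_
    rw [ENNReal.tsum_mul_right]
    exact mul_le_mul' (tsum_twoPow_comp_le (ha b) ε) le_rfl
  have h2 : ∑' a : ℤ, ∑' b : ℤ, twoPow (-(ε * |((P * a - Q * b : ℤ) : ℝ)|)) *
      ∑' k : ℤ, twoPow (-(1 / 2 * |(k : ℝ) - (b + (P * a - Q * b) : ℤ)|)) * x k ≤
        geomSum ε * (geomSum (1 / 2) * ∑' k, x k) := by
    rw [ENNReal.tsum_comm]
    calc _ ≤ ∑' b : ℤ, ∑' m : ℤ, twoPow (-(ε * |(m : ℝ)|)) *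
          ∑' k : ℤ, twoPow (-(1 / 2 * |(k : ℝ) - (b + m : ℤ)|)) * x k :=
          ENNReal.tsum_le_tsum fun b =>
            ENNReal.tsum_comp_le_tsum_of_injective (ha b) fun m : ℤ =>
              twoPow (-(ε * |(m : ℝ)|)) *
                ∑' k : ℤ, twoPow (-(1 / 2 * |(k : ℝ) - (b + m : ℤ)|)) * x k
      _ = ∑' m : ℤ, twoPow (-(ε * |(m : ℝ)|)) * ∑' b : ℤ,
          ∑' k : ℤ, twoPow (-(1 / 2 * |(k : ℝ) - (b + m : ℤ)|)) * x k := by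
          rw [ENNReal.tsum_comm]; simp only [ENNReal.tsum_mul_left]
      _ = ∑' m : ℤ, twoPow (-(ε * |(m : ℝ)|)) * (geomSum (1 / 2) * ∑' k, x k) := by
          refine tsum_congr fun m => ?_
          rw [← tsum_tsum_twoPow_sub_mul, ← (Equiv.addRight m).tsum_eq fun j : ℤ =>
            ∑' k : ℤ, twoPow (-(1 / 2 * |(k : ℝ) - j|)) * x k]
          rfl
      _ = _ := by rw [ENNReal.tsum_mul_right]; rfl
  have h3 : ∑' a : ℤ, ∑' b : ℤ, twoPow (-(ε * |((P * a - Q * b : ℤ) : ℝ)|)) *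
      ∑' l : ℤ, twoPow (-(1 / 2 * |(l : ℝ) - a|)) * y l ≤
        geomSum ε * (geomSum (1 / 2) * ∑' l, y l) := by
    rw [← tsum_tsum_twoPow_sub_mul, ← ENNReal.tsum_mul_left]
    refine ENNReal.tsum_le_tsum fun a => ?_
    rw [ENNReal.tsum_mul_right]
    exact mul_le_mul' (tsum_twoPow_comp_le (hb a) ε) le_rfl
  simp only [mul_add, ENNReal.tsum_add, mul_left_comm _ (geomSum (1 / 2)), ENNReal.tsum_mul_left]
  refine (add_le_add (add_le_add h1 (mul_le_mul' le_rfl h2)) (mul_le_mul' le_rfl h3)).trans ?_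
  refine le_of_le_of_eq (le_add_of_nonneg_right
    (zero_le (a := geomSum ε * (geomSum ε * ∑' l, y l)))) ?_
  ring

lemma volume_box (μ : Fin n → ℝ) :
    volume {ξ : EuclideanSpace ℝ (Fin n) | ∀ k, |ξ k| ≤ 2 ^ μ k} = twoPow (n + ∑ k, μ k) := by
  have hpre : {ξ : EuclideanSpace ℝ (Fin n) | ∀ k, |ξ k| ≤ 2 ^ μ k} =
      WithLp.ofLp ⁻¹' (Set.pi univ fun k => Icc (-(2 ^ μ k : ℝ)) (2 ^ μ k)) := by
    ext ξ; simp only [mem_ofPred_eq, mem_preimage, mem_univ_pi, mem_Icc, abs_le]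
  rw [hpre, (PiLp.volume_preserving_ofLp (Fin n)).measure_preimage
    (MeasurableSet.univ_pi fun k => measurableSet_Icc).nullMeasurableSet, volume_pi_pi]
  have h1 : ∀ k, volume (Icc (-(2 ^ μ k : ℝ)) (2 ^ μ k)) = twoPow (1 + μ k) := fun k => by
    rw [Real.volume_Icc, twoPow_eq_ofReal, Real.rpow_add (by norm_num), Real.rpow_one]
    congr 1; ring
  simp only [h1]
  have h2 : ∀ s : Finset (Fin n), ∏ k ∈ s, twoPow (1 + μ k) = twoPow (∑ k ∈ s, (1 + μ k)) :=
    fun s => by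
      induction s using Finset.induction_on with
      | empty => simp
      | insert i s hi ih => 
        rw [Finset.prod_insert hi, Finset.sum_insert hi, twoPow_add _ (Finset.sum _ _), ih]
  rw [h2, Finset.sum_add_distrib]
  simp

/-- The spectral box on which the `p`-th variable dominates anisotropically, `|ξ_p| ~ 2 ^ a` and
`|ξ_q| ~ 2 ^ b`. -/
def freqBox (r : Fin n → ℕ) (p q : Fin n) (a b : ℤ) : Set (EuclideanSpace ℝ (Fin n)) :=
  {ξ | ((2 : ℝ) ^ (a : ℝ) < |ξ p| ∧ |ξ p| ≤ 2 ^ (a + 1 : ℝ)) ∧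
    ((2 : ℝ) ^ (b : ℝ) < |ξ q| ∧ |ξ q| ≤ 2 ^ (b + 1 : ℝ)) ∧
    ∀ k, |ξ k| ^ r k ≤ |ξ p| ^ r p}

lemma measurableSet_freqBox (r : Fin n → ℕ) (p q : Fin n) (a b : ℤ) :
    MeasurableSet (freqBox r p q a b) := by
  have hm : ∀ k, Measurable fun ξ : EuclideanSpace ℝ (Fin n) => |ξ k| := fun k => by
    have : Measurable fun ξ : EuclideanSpace ℝ (Fin n) => ξ k := by fun_prop
    exact measurable_norm.comp this
  refine ((measurableSet_lt measurable_const (hm p)).inter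
    (measurableSet_le (hm p) measurable_const)).inter
    (((measurableSet_lt measurable_const (hm q)).inter
    (measurableSet_le (hm q) measurable_const)).inter ?_)
  have : {ξ : EuclideanSpace ℝ (Fin n) | ∀ k, |ξ k| ^ r k ≤ |ξ p| ^ r p} =
      ⋂ k, {ξ | |ξ k| ^ r k ≤ |ξ p| ^ r p} := by ext; simp
  have h2 : MeasurableSet (⋂ k, {ξ : EuclideanSpace ℝ (Fin n) | |ξ k| ^ r k ≤ |ξ p| ^ r p}) :=
    MeasurableSet.iInter fun k => measurableSet_le ((hm k).pow_const _) ((hm p).pow_const _)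
  rwa [← this] at h2

lemma neg_le_of_mem_freqBox {r : Fin n → ℕ} {p q : Fin n} {a b : ℤ}
    {ξ : EuclideanSpace ℝ (Fin n)} (hξ : ξ ∈ freqBox r p q a b) :
    -(r p : ℤ) ≤ r p * a - r q * b := by
  obtain ⟨⟨_, h2⟩, ⟨h3, _⟩, h5⟩ := hξ
  have h : (2 : ℝ) ^ (r q * b : ℝ) ≤ 2 ^ (r p * (a + 1) : ℝ) := by
    rw [mul_comm, Real.rpow_mul_natCast (by norm_num), mul_comm,
      Real.rpow_mul_natCast (by norm_num)]
    exact (pow_le_pow_left₀ (by positivity) h3.le _).trans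
      ((h5 q).trans (pow_le_pow_left₀ (abs_nonneg _) h2 _))
  rw [Real.rpow_le_rpow_left_iff (by norm_num)] at h
  have h' : (r q : ℤ) * b ≤ r p * (a + 1) := by exact_mod_cast h
  linarith

lemma rpow_sum_le_of_mem_freqBox {r : Fin n → ℕ} {p q : Fin n} {a b : ℤ}
    {ξ : EuclideanSpace ℝ (Fin n)} (hξ : ξ ∈ freqBox r p q a b) (e : ℝ) :
    (∑ k, |ξ k| ^ r k) ^ e ≤ (n * 2 ^ r p) ^ |e| * 2 ^ (r p * a * e) := by
  obtain ⟨⟨h1, h2⟩, -, h5⟩ := hξ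
  have hpos : (0 : ℝ) < 2 ^ (r p * a : ℝ) := by positivity
  have hlow : (2 : ℝ) ^ (r p * a : ℝ) ≤ ∑ k, |ξ k| ^ r k := by
    calc (2 : ℝ) ^ (r p * a : ℝ) ≤ |ξ p| ^ r p := by
          rw [mul_comm, Real.rpow_mul_natCast (by norm_num)]
          exact pow_le_pow_left₀ (by positivity) h1.le _
      _ ≤ _ := Finset.single_le_sum (f := fun k => |ξ k| ^ r k) (fun k _ => by positivity)
          (Finset.mem_univ p)
  have hup : ∑ k, |ξ k| ^ r k ≤ n * 2 ^ r p * 2 ^ (r p * a : ℝ) := by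
    calc ∑ k, |ξ k| ^ r k ≤ ∑ _k : Fin n, |ξ p| ^ r p := Finset.sum_le_sum fun k _ => h5 k
      _ = n * |ξ p| ^ r p := by simp
      _ ≤ n * (2 ^ (a + 1 : ℝ)) ^ r p := by gcongr
      _ = _ := by
        rw [Real.rpow_add (by norm_num), Real.rpow_one, mul_pow, mul_comm (r p : ℝ),
          Real.rpow_mul_natCast (by norm_num)]
        ring
  obtain ⟨σ, hσ⟩ : ∃ σ, σ = (∑ k, |ξ k| ^ r k) / 2 ^ (r p * a : ℝ) := ⟨_, rfl⟩
  have hσ1 : 1 ≤ σ := by rw [hσ, le_div_iff₀ hpos]; simpa using hlow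
  have hσ2 : σ ≤ n * 2 ^ r p := by rw [hσ, div_le_iff₀ hpos]; exact hup
  have hs : ∑ k, |ξ k| ^ r k = σ * 2 ^ (r p * a : ℝ) := by rw [hσ]; field_simp
  rw [hs, Real.mul_rpow (by linarith) hpos.le, ← Real.rpow_mul (by norm_num)]
  gcongr
  exact (Real.rpow_le_rpow_of_exponent_le hσ1 (le_abs_self e)).trans
    (Real.rpow_le_rpow (by linarith) hσ2 (abs_nonneg e))

/-- Binary logarithms of the side lengths of a box containing `freqBox` and its translates. -/
noncomputable def boxExp (r : Fin n → ℕ) (p q : Fin n) (a b : ℤ) (k : Fin n) : ℝ :=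
  if k = p then a + 2 else if k = q then b + 2 else r p / r k * (a + 1)

lemma sum_boxExp {r : Fin n → ℕ} (hr : ∀ k, 0 < r k) {p q : Fin n} (hpq : q ≠ p) (a b : ℤ) :
    ∑ k, boxExp r p q a b k = r p * (∑ k, (r k : ℝ)⁻¹) * (a + 1) + b + 3 -
      r p / r q * (a + 1) := by
  have hp : (r p : ℝ) ≠ 0 := by exact_mod_cast (hr p).ne'
  have h : ∀ k, boxExp r p q a b k = r p / r k * (a + 1) +
      ((if k = p then (1 : ℝ) else 0) +
        if k = q then (b + 2 - r p / r q * (a + 1) : ℝ) else 0) := by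
    intro k
    by_cases h1 : k = p
    · subst h1; simp [boxExp, hpq.symm, hp]; ring
    · by_cases h2 : k = q
      · subst h2; simp [boxExp, h1]
      · simp [boxExp, h1, h2]
  simp only [h, Finset.sum_add_distrib, Finset.sum_ite_eq', Finset.mem_univ, if_true,
    ← Finset.sum_mul, div_eq_mul_inv, ← Finset.mul_sum]
  ring

lemma abs_le_of_mem_freqBox {r : Fin n → ℕ} (hr : ∀ k, 0 < r k) {p q : Fin n} {a b : ℤ}
    {ξ : EuclideanSpace ℝ (Fin n)} (hξ : ξ ∈ freqBox r p q a b) (k : Fin n) :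
    |ξ k| ≤ 2 ^ (r p / r k * (a + 1) : ℝ) := by
  obtain ⟨⟨_, h2⟩, -, h5⟩ := hξ
  have hk : (r k : ℝ) ≠ 0 := by exact_mod_cast (hr k).ne'
  refine le_of_pow_le_pow_left₀ (hr k).ne' (by positivity) ?_
  refine (h5 k).trans ((pow_le_pow_left₀ (abs_nonneg _) h2 _).trans_eq ?_)
  rw [← Real.rpow_mul_natCast (by norm_num), ← Real.rpow_mul_natCast (by norm_num)]
  congr 1; field_simp

lemma mem_box_of_mem_freqBox {r : Fin n → ℕ} (hr : ∀ k, 0 < r k) {p q : Fin n} {a b : ℤ}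
    {ξ η : EuclideanSpace ℝ (Fin n)} (hξ : ξ ∈ freqBox r p q a b)
    (h1 : |η p - ξ p| ≤ 2 ^ (a : ℝ)) (h2 : |η q - ξ q| ≤ 2 ^ (b : ℝ))
    (h3 : ∀ k, k ≠ p → k ≠ q → η k = ξ k) (k : Fin n) : |η k| ≤ 2 ^ boxExp r p q a b k := by
  have key : ∀ (s : ℝ) (x y : ℝ), |x| ≤ 2 ^ (s + 1) → |y - x| ≤ 2 ^ s → |y| ≤ 2 ^ (s + 2) := by
    intro s x y hx hy
    have h0 : (0 : ℝ) < 2 ^ s := by positivity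
    rw [Real.rpow_add (by norm_num), Real.rpow_one] at hx
    rw [Real.rpow_add (by norm_num), Real.rpow_two]
    have := abs_add_le x (y - x)
    rw [add_sub_cancel] at this
    linarith
  by_cases hkp : k = p
  · subst hkp; simpa [boxExp] using key _ _ _ hξ.1.2 h1
  · by_cases hkq : k = q
    · subst hkq; simpa [boxExp, hkp] using key _ _ _ hξ.2.1.2 h2
    · rw [h3 k hkp hkq]; simpa [boxExp, hkp, hkq] using abs_le_of_mem_freqBox hr hξ k

lemma fwdDiff_iter_congr_ae (v : EuclideanSpace ℝ (Fin n)) (s : ℕ)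
    {F G : EuclideanSpace ℝ (Fin n) → ℝ} (h : F =ᵐ[volume] G) :
    (fwdDiff v)^[s] F =ᵐ[volume] (fwdDiff v)^[s] G := by
  induction s generalizing F G with
  | zero => exact h
  | succ s ih =>
    refine ih ?_
    have h' : (fun x => F (x + v)) =ᵐ[volume] fun x => G (x + v) :=
      (measurePreserving_add_right volume v).quasiMeasurePreserving.ae_eq_comp h
    filter_upwards [h, h'] with x h1 h2
    simp only [fwdDiff] at *
    rw [h1, h2]

lemma integrable_fwdDiff_iter (v : EuclideanSpace ℝ (Fin n)) (s : ℕ)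
    {F : EuclideanSpace ℝ (Fin n) → ℝ} (hF : Integrable F) : Integrable ((fwdDiff v)^[s] F) := by
  induction s generalizing F with
  | zero => exact hF
  | succ s ih => exact ih (integrable_fwdDiff v hF)

lemma fwdDiff_iter_comm (v w : EuclideanSpace ℝ (Fin n)) (s t : ℕ)
    (F : EuclideanSpace ℝ (Fin n) → ℝ) :
    (fwdDiff v)^[s] ((fwdDiff w)^[t] F) = (fwdDiff w)^[t] ((fwdDiff v)^[s] F) := by
  have h : Function.Commute (fwdDiff v) (fwdDiff w (G := ℝ)) := fun F => by
    ext x; simp only [fwdDiff, add_right_comm x v w]; ring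
  exact (h.iterate_iterate s t).eq F

lemma ofReal_rpow_neg_pow_le (a : ℤ) (s : ℕ) :
    ENNReal.ofReal (2 ^ (-(a : ℝ) - 2)) ^ s ≤ twoPow (-(s * a)) := by
  rw [← twoPow_eq_ofReal, ← ENNReal.rpow_natCast, ← twoPow_mul]
  refine twoPow_mono ?_
  have : (0 : ℝ) ≤ s := by positivity
  nlinarith

lemma mixed_diff_bounds {p q : Fin n} (hpq : q ≠ p) {sp : ℕ} (hsp : 0 < sp) (sq : ℕ) (a : ℤ)
    (h : ℝ) {F G : EuclideanSpace ℝ (Fin n) → ℝ} (hw : IsWeakDeriv p sp F G) (hF : Integrable F)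
    (hG : Measurable G) (hi : Integrable G) {ψ : ℝ → ℝ≥0∞} (hψ : Measurable ψ)
    (hm : ∀ θ : ℝ → ℝ≥0∞, Measurable θ → ∫⁻ x, ‖G x‖ₑ * θ (x q) = ∫⁻ t, ψ t * θ t)
    {u : EuclideanSpace ℝ (Fin n) → ℝ}
    (hu : u = (fwdDiff (h • EuclideanSpace.single q (1 : ℝ)))^[sq]
      ((fwdDiff ((2 : ℝ) ^ (-(a : ℝ) - 2) • EuclideanSpace.single p (1 : ℝ)))^[sp] F)) :
    (∀ θ : ℝ → ℝ≥0∞, Measurable θ → ∫⁻ x, ‖(u x : ℂ)‖ₑ * θ (x q) ≤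
      twoPow (-(sp * a)) * ∫⁻ t, binSum sq h ψ t * θ t) ∧
    ∀ τ θ : ℝ → ℝ≥0∞, Measurable τ → Measurable θ →
      ∫⁻ x, ‖(u x : ℂ)‖ₑ * (θ (x q) * τ (x p)) ≤
        twoPow (-((sp - 1) * a)) * (∫⁻ t, τ t) * ∫⁻ t, binSum sq h ψ t * θ t := by
  have hn : ∀ x, ‖(u x : ℂ)‖ₑ = ‖u x‖ₑ := fun x => by
    rw [← ofReal_norm, ← ofReal_norm, Complex.norm_real]
  have hu' : u =ᵐ[volume] (fwdDiff (h • EuclideanSpace.single q (1 : ℝ)))^[sq]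
      ((fwdAvg (EuclideanSpace.single p 1) (2 ^ (-(a : ℝ) - 2)))^[sp] G) := by
    rw [hu]
    exact fwdDiff_iter_congr_ae _ _ (hw.fwdDiff_iter_ae_eq hF hG hi (by positivity))
  simp only [hn]
  refine ⟨fun θ hθ => ?_, fun τ θ hτ hθ => ?_⟩
  · exact (mixed_diff_marginal_le hpq sp sq _ h hG hu' hψ hm hθ).trans
      (mul_le_mul' (ofReal_rpow_neg_pow_le a sp) le_rfl)
  · obtain ⟨m, rfl⟩ : ∃ m, sp = m + 1 := ⟨sp - 1, by omega⟩
    refine (mixed_diff_marginal_mul_le hpq m sq _ h hG hu' hψ hm hθ hτ).trans ?_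
    have := ofReal_rpow_neg_pow_le a m
    have e : -(((m + 1 : ℕ) : ℝ) - 1) * (a : ℝ) = -(m * a) := by push_cast; ring
    rw [← neg_mul, e]
    exact mul_le_mul' (mul_le_mul' this le_rfl) le_rfl

lemma quarter_le_abs_mul {a : ℤ} {x : ℝ} (h1 : (2 : ℝ) ^ (a : ℝ) < |x|)
    (h2 : |x| ≤ 2 ^ (a + 1 : ℝ)) :
    1 / 4 ≤ |(2 : ℝ) ^ (-(a : ℝ) - 2) * x| ∧ |(2 : ℝ) ^ (-(a : ℝ) - 2) * x| ≤ 1 / 2 := by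
  have hp : (0 : ℝ) < 2 ^ (-(a : ℝ) - 2) := by positivity
  rw [abs_mul, abs_of_pos hp]
  have e1 : (2 : ℝ) ^ (-(a : ℝ) - 2) * 2 ^ (a : ℝ) = 1 / 4 := by
    rw [← Real.rpow_add (by norm_num), show -(a : ℝ) - 2 + a = -2 by ring,
      Real.rpow_neg (by norm_num), Real.rpow_two]
    norm_num
  have e2 : (2 : ℝ) ^ (-(a : ℝ) - 2) * 2 ^ (a + 1 : ℝ) = 1 / 2 := by
    rw [Real.rpow_add (by norm_num) (a : ℝ), ← mul_assoc, e1]; norm_num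
  exact ⟨e1 ▸ mul_le_mul_of_nonneg_left h1.le hp.le, e2 ▸ mul_le_mul_of_nonneg_left h2 hp.le⟩

/-- The constant of the estimate over one spectral box. -/
noncomputable def boxConst (r : Fin n → ℕ) (p q : Fin n) (e : ℝ) : ℝ≥0∞ :=
  ENNReal.ofReal ((n * 2 ^ r p) ^ |e|) *
    twoPow (n + (r p * (∑ k, (r k : ℝ)⁻¹) + 3 - r p / r q)) *
    (r q + 1 : ℕ) * (r p + 1 : ℕ) * twoPow (2 * r p)

lemma lintegral_freqBox_le {r : Fin n → ℕ} (hr : ∀ k, 0 < r k) {p q : Fin n} (hpq : q ≠ p)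
    {f g₁ g₂ : EuclideanSpace ℝ (Fin n) → ℝ} (hf : Integrable f)
    (hg₁ : Measurable g₁) (hi₁ : Integrable g₁) (hg₂ : Measurable g₂) (hi₂ : Integrable g₂)
    (hw₁ : IsWeakDeriv p (r p) f g₁) (hw₂ : IsWeakDeriv q (r q) f g₂)
    {ψ₁ ψ₂ : ℝ → ℝ≥0∞} (hψ₁ : Measurable ψ₁) (hψ₂ : Measurable ψ₂)
    (hm₁ : ∀ θ : ℝ → ℝ≥0∞, Measurable θ → ∫⁻ x, ‖g₁ x‖ₑ * θ (x q) = ∫⁻ t, ψ₁ t * θ t)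
    (hm₂ : ∀ θ : ℝ → ℝ≥0∞, Measurable θ → ∫⁻ x, ‖g₂ x‖ₑ * θ (x p) = ∫⁻ t, ψ₂ t * θ t)
    {e : ℝ} (he : e = 1 - ∑ k, (r k : ℝ)⁻¹) (a b : ℤ) :
    ∫⁻ ξ in freqBox r p q a b, ENNReal.ofReal
        (‖fourierTf (fun x => (f x : ℂ)) ξ‖ * (∑ k, |ξ k| ^ r k) ^ e) ≤
      boxConst r p q e * (twoPow (-((1 / (2 * r q)) * |((r p * a - r q * b : ℤ) : ℝ)|)) *
        (∑' k : ℤ, twoPow (-((1 / (2 * r q)) * |(k : ℝ) - b|)) *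
            (twoPow (-k) * (2 ^ r q * rearr ψ₁ (k + 1))) +
          geomSum (1 / 2) * (∑' k : ℤ,
            twoPow (-(1 / 2 * |(k : ℝ) - (b + (r p * a - r q * b) : ℤ)|)) *
            (twoPow (-k) * (2 ^ r q * rearr ψ₁ (k + 1)))) +
          geomSum (1 / 2) * (∑' l : ℤ, twoPow (-(1 / 2 * |(l : ℝ) - a|)) *
            (twoPow (-l) * (2 ^ r p * rearr ψ₂ (l + 1)))))) := by
  by_cases hmP : -(r p : ℤ) ≤ r p * a - r q * b
  swap
  · have : freqBox r p q a b = ∅ :=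
      eq_empty_of_forall_notMem fun ξ hξ => hmP (neg_le_of_mem_freqBox hξ)
    simp [this]
  have hrq : (1 : ℝ) ≤ r q := by exact_mod_cast hr q
  have hrp : (1 : ℝ) ≤ r p := by exact_mod_cast hr p
  set va : EuclideanSpace ℝ (Fin n) :=
    (2 : ℝ) ^ (-(a : ℝ) - 2) • EuclideanSpace.single p (1 : ℝ) with hva
  set vb : EuclideanSpace ℝ (Fin n) :=
    (2 : ℝ) ^ (-(b : ℝ) - 2) • EuclideanSpace.single q (1 : ℝ) with hvb
  set u := (fwdDiff vb)^[r q] ((fwdDiff va)^[r p] f) with hu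
  have hu2 : u = (fwdDiff va)^[r p] ((fwdDiff vb)^[r q] f) := fwdDiff_iter_comm _ _ _ _ _
  have hui : Integrable u := integrable_fwdDiff_iter _ _ (integrable_fwdDiff_iter _ _ hf)
  have hfin : ∀ {g : EuclideanSpace ℝ (Fin n) → ℝ} {ψ : ℝ → ℝ≥0∞} {k : Fin n}, Integrable g →
      (∀ θ : ℝ → ℝ≥0∞, Measurable θ → ∫⁻ x, ‖g x‖ₑ * θ (x k) = ∫⁻ t, ψ t * θ t) →
      ∫⁻ t, ψ t ≠ ⊤ := fun {g ψ k} hg h => by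
    have := h 1 measurable_one
    simp only [Pi.one_apply, mul_one] at this
    rw [← this]
    exact hg.2.ne
  obtain ⟨M1, M4⟩ := mixed_diff_bounds hpq (hr p) (r q) a _ hw₁ hf hg₁ hi₁ hψ₁ hm₁ hu
  obtain ⟨M2, M3⟩ := mixed_diff_bounds hpq.symm (hr q) (r p) b _ hw₂ hf hg₂ hi₂ hψ₂ hm₂ hu2
  set R' : Set (EuclideanSpace ℝ (Fin n)) := {ξ | ∀ k, |ξ k| ≤ 2 ^ boxExp r p q a b k} with hR'
  have hR'm : MeasurableSet R' := by
    have : R' = ⋂ k, {ξ : EuclideanSpace ℝ (Fin n) | |ξ k| ≤ 2 ^ boxExp r p q a b k} := by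
      ext; simp [hR']
    rw [this]
    refine MeasurableSet.iInter fun k => measurableSet_le ?_ measurable_const
    have : Measurable fun ξ : EuclideanSpace ℝ (Fin n) => ξ k := by fun_prop
    exact measurable_norm.comp this
  have hsub : freqBox r p q a b ⊆ R' := fun ξ hξ =>
    mem_box_of_mem_freqBox hr hξ (by simp; positivity) (by simp; positivity) fun _ _ _ => rfl
  have hshp : ∀ ξ ∈ freqBox r p q a b, ∀ s ∈ Ioc (0 : ℝ) (2 ^ (a : ℝ)),
      ξ - s • EuclideanSpace.single p (1 : ℝ) ∈ R' := fun ξ hξ s hs => by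
    refine mem_box_of_mem_freqBox hr hξ ?_ ?_ ?_
    · simpa [abs_of_pos hs.1] using hs.2
    · simp [hpq]; positivity
    · intro k h1 h2; simp [h1]
  have hshq : ∀ ξ ∈ freqBox r p q a b, ∀ s ∈ Ioc (0 : ℝ) (2 ^ (b : ℝ)),
      ξ - s • EuclideanSpace.single q (1 : ℝ) ∈ R' := fun ξ hξ s hs => by
    refine mem_box_of_mem_freqBox hr hξ ?_ ?_ ?_
    · simp [hpq.symm]; positivity
    · simpa [abs_of_pos hs.1] using hs.2
    · intro k h1 h2; simp [h2]
  set W : ℝ≥0∞ := ENNReal.ofReal ((n * 2 ^ r p) ^ |e|) * twoPow (r p * a * e) with hW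
  have hWV : W * volume R' ≤ ENNReal.ofReal ((n * 2 ^ r p) ^ |e|) *
      twoPow (n + (r p * (∑ k, (r k : ℝ)⁻¹) + 3 - r p / r q)) *
      twoPow ((r p : ℤ) * a - 2 * (1 / (2 * r q)) * (r p * a - r q * b : ℤ)) := by
    rw [hR', volume_box, sum_boxExp hr hpq, hW, mul_assoc (ENNReal.ofReal _),
      mul_assoc (ENNReal.ofReal _), ← twoPow_add, ← twoPow_add]
    have he' : ∑ k, (r k : ℝ)⁻¹ = 1 - e := by rw [he]; ring
    rw [he']
    refine le_of_eq ?_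
    congr 2
    push_cast
    field_simp
    ring
  have hbound : ∀ ξ ∈ freqBox r p q a b, ENNReal.ofReal
      (‖fourierTf (fun x => (f x : ℂ)) ξ‖ * (∑ k, |ξ k| ^ r k) ^ e) ≤
      W * ‖fourierTf (fun x => (u x : ℂ)) ξ‖ₑ := fun ξ hξ => by
    rw [ENNReal.ofReal_mul (norm_nonneg _), ofReal_norm, mul_comm]
    refine mul_le_mul' ?_ ?_
    · rw [hW, twoPow_eq_ofReal, ← ENNReal.ofReal_mul (by positivity)]
      exact ENNReal.ofReal_le_ofReal (rpow_sum_le_of_mem_freqBox hξ e)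
    · have ha := quarter_le_abs_mul hξ.1.1 hξ.1.2
      have hb := quarter_le_abs_mul hξ.2.1.1 hξ.2.1.2
      exact (norm_fourierTf_le_fwdDiff_iter p _ (r p) hf ha.1 ha.2).trans
        (norm_fourierTf_le_fwdDiff_iter q _ (r q) (integrable_fwdDiff_iter _ _ hf) hb.1 hb.2)
  calc _ ≤ ∫⁻ ξ in freqBox r p q a b, W * ‖fourierTf (fun x => (u x : ℂ)) ξ‖ₑ :=
        setLIntegral_mono' (measurableSet_freqBox r p q a b) hbound
    _ = W * ∫⁻ ξ in freqBox r p q a b, ‖fourierTf (fun x => (u x : ℂ)) ξ‖ₑ :=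
        lintegral_const_mul _ (continuous_fourierTf hui.ofReal).measurable.enorm
    _ ≤ _ := lintegral_box_fourierTf_le hui.ofReal (P := r p) (Q := r q) (a := a) (b := b)
        (fun k => measurableSet_levelShell (r q) (2 ^ (-(b : ℝ) - 2)) hψ₁ k)
        (fun l => measurableSet_levelShell (r p) (2 ^ (-(a : ℝ) - 2)) hψ₂ l)
        (pairwise_disjoint_levelShell _ _ _) (pairwise_disjoint_levelShell _ _ _)
        (NA := r q + 1) (NB := r p + 1) (by omega) (by omega)
        (fun k => volume_levelShell_le _ _ _ k) (fun l => volume_levelShell_le _ _ _ l)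
        (c₁ := fun k => 2 ^ r q * rearr ψ₁ (k + 1)) (c₂ := fun l => 2 ^ r p * rearr ψ₂ (l + 1))
        (fun k t ht => binSum_le_of_notMem _ _ _ ht.2)
        (fun l t ht => binSum_le_of_notMem _ _ _ ht.2)
        (ae_binSum_eq_zero_of_notMem_levelShell _ _ hψ₁ (hfin hi₁ hm₁))
        (ae_binSum_eq_zero_of_notMem_levelShell _ _ hψ₂ (hfin hi₂ hm₂))
        (by positivity) rfl hmP
        (by exact_mod_cast M1) M2 (by exact_mod_cast M3) (by exact_mod_cast M4)
        (measurableSet_freqBox r p q a b) hR'm hsub hshp hshq (by positivity)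
        (by
          rw [div_le_div_iff₀ (by positivity) (by positivity)]
          linarith) hWV

lemma tsum_twoPow_mul_rearr_succ_le {ψ : ℝ → ℝ≥0∞} (hψ : Measurable ψ) (s : ℕ) :
    ∑' k : ℤ, twoPow (-k) * (2 ^ s * rearr ψ (k + 1)) ≤
      2 ^ (s + 1) * geomSum 1 * ∫⁻ t, ψ t := by
  have h : ∀ k : ℤ, twoPow (-k) * (2 ^ s * rearr ψ (k + 1)) =
      2 ^ (s + 1) * (twoPow (-((k + 1 : ℤ) : ℝ)) * rearr ψ (k + 1)) := fun k => by
    have : twoPow (-k) = 2 * twoPow (-((k + 1 : ℤ) : ℝ)) := by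
      rw [← twoPow_one, ← twoPow_add]; congr 1; push_cast; ring
    rw [this]; ring
  simp only [h, ENNReal.tsum_mul_left]
  rw [mul_assoc]
  exact mul_le_mul' le_rfl (((Equiv.addRight (1 : ℤ)).tsum_eq fun k : ℤ =>
    twoPow (-k) * rearr ψ k).trans_le (tsum_twoPow_mul_rearr_le hψ))

/-- The constant of the estimate over the region where the `p`-th variable dominates. -/
noncomputable def regionConst (r : Fin n → ℕ) (p q : Fin n) (e : ℝ) : ℝ≥0∞ :=
  boxConst r p q e * (geomSum (1 / (2 * r q)) * (geomSum (1 / (2 * r q)) +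
    geomSum (1 / 2) * geomSum (1 / 2)) * (2 ^ (r q + r p + 1) * geomSum 1))

lemma regionConst_ne_top {r : Fin n → ℕ} (hr : ∀ k, 0 < r k) (p q : Fin n) (e : ℝ) :
    regionConst r p q e ≠ ⊤ := by
  have h1 : geomSum (1 / (2 * r q)) ≠ ⊤ := geomSum_ne_top (by have := hr q; positivity)
  have h2 : geomSum (1 / 2) ≠ ⊤ := geomSum_ne_top (by norm_num)
  have h3 : geomSum 1 ≠ ⊤ := geomSum_ne_top one_pos
  have h4 : boxConst r p q e ≠ ⊤ := by
    unfold boxConst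
    exact mul_ne_top (mul_ne_top (mul_ne_top (mul_ne_top ofReal_ne_top (twoPow_ne_top _))
      (natCast_ne_top _)) (natCast_ne_top _)) (twoPow_ne_top _)
  exact mul_ne_top h4 (mul_ne_top (mul_ne_top h1 (add_ne_top.2 ⟨h1, mul_ne_top h2 h2⟩))
    (mul_ne_top (pow_ne_top ofNat_ne_top) h3))

lemma tsum_lintegral_freqBox_le {r : Fin n → ℕ} (hr : ∀ k, 0 < r k) {p q : Fin n} (hpq : q ≠ p)
    {f g₁ g₂ : EuclideanSpace ℝ (Fin n) → ℝ} (hf : Integrable f)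
    (hg₁ : Measurable g₁) (hi₁ : Integrable g₁) (hg₂ : Measurable g₂) (hi₂ : Integrable g₂)
    (hw₁ : IsWeakDeriv p (r p) f g₁) (hw₂ : IsWeakDeriv q (r q) f g₂)
    {e : ℝ} (he : e = 1 - ∑ k, (r k : ℝ)⁻¹) :
    ∑' a : ℤ, ∑' b : ℤ, ∫⁻ ξ in freqBox r p q a b, ENNReal.ofReal
        (‖fourierTf (fun x => (f x : ℂ)) ξ‖ * (∑ k, |ξ k| ^ r k) ^ e) ≤
      regionConst r p q e * ((∫⁻ x, ‖g₁ x‖ₑ) + ∫⁻ x, ‖g₂ x‖ₑ) := by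
  obtain ⟨ψ₁, hψ₁, hm₁⟩ := exists_marginal_density q hg₁ hi₁
  obtain ⟨ψ₂, hψ₂, hm₂⟩ := exists_marginal_density p hg₂ hi₂
  have e₁ : ∫⁻ t, ψ₁ t = ∫⁻ x, ‖g₁ x‖ₑ := by simpa using (hm₁ 1 measurable_one).symm
  have e₂ : ∫⁻ t, ψ₂ t = ∫⁻ x, ‖g₂ x‖ₑ := by simpa using (hm₂ 1 measurable_one).symm
  refine (ENNReal.tsum_le_tsum fun a => ENNReal.tsum_le_tsum fun b =>
    lintegral_freqBox_le hr hpq hf hg₁ hi₁ hg₂ hi₂ hw₁ hw₂ hψ₁ hψ₂ hm₁ hm₂ he a b).trans ?_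
  simp only [ENNReal.tsum_mul_left]
  rw [regionConst, mul_assoc]
  refine mul_le_mul' le_rfl ((tsum_tsum_box_le (P := r p) (Q := r q)
    (by exact_mod_cast (hr p).ne') (by exact_mod_cast (hr q).ne') _ _ _).trans ?_)
  rw [mul_assoc _ (2 ^ _ * _)]
  refine mul_le_mul' le_rfl ?_
  rw [mul_add]
  refine add_le_add ((tsum_twoPow_mul_rearr_succ_le hψ₁ _).trans ?_)
    ((tsum_twoPow_mul_rearr_succ_le hψ₂ _).trans ?_)
  · rw [e₁]
    gcongr
    · norm_num
    · omega
  · rw [e₂]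
    gcongr
    · norm_num
    · omega

lemma ae_apply_ne_zero (k : Fin n) : ∀ᵐ ξ : EuclideanSpace ℝ (Fin n), ξ k ≠ 0 :=
  (PiLp.volume_preserving_ofLp (Fin n)).quasiMeasurePreserving.ae
    (p := fun y : Fin n → ℝ => y k ≠ 0)
    (Measure.ae_eval_ne (μ := fun _ : Fin n => (volume : Measure ℝ)) k (0 : ℝ))

lemma exists_mem_freqBox [Nonempty (Fin n)] (r : Fin n → ℕ) (q : Fin n → Fin n)
    {ξ : EuclideanSpace ℝ (Fin n)} (hξ : ∀ k, ξ k ≠ 0) :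
    ∃ (p : Fin n) (a b : ℤ), ξ ∈ freqBox r p (q p) a b := by
  obtain ⟨p, hp⟩ := Finite.exists_max fun k => |ξ k| ^ r k
  have key : ∀ k, ∃ a : ℤ, (2 : ℝ) ^ (a : ℝ) < |ξ k| ∧ |ξ k| ≤ 2 ^ (a + 1 : ℝ) := fun k => by
    obtain ⟨a, h1, h2⟩ := exists_mem_Ioc_zpow (abs_pos.2 (hξ k)) (one_lt_two (α := ℝ))
    refine ⟨a, ?_, ?_⟩
    · rwa [Real.rpow_intCast]
    · rwa [← Real.rpow_intCast, Int.cast_add, Int.cast_one] at h2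
  obtain ⟨a, ha⟩ := key p
  obtain ⟨b, hb⟩ := key (q p)
  exact ⟨p, a, b, ha, hb, hp⟩

end

/-- **Anisotropic Hardy-type inequality for Fourier transforms (Kolyada).** Let `n ≥ 2`,
`r₁,…,r_n ∈ ℕ`, `r = n(Σ 1/r_k)⁻¹`. There is `c = c(n, r₁,…,r_n) > 0` such that for
every `f ∈ W₁^{r₁,…,r_n}(ℝⁿ)`, i.e. `f ∈ L¹` admitting weak derivatives
`D_k^{r_k} f = g_k ∈ L¹(ℝⁿ)`,
`∫ |f̂(ξ)| (Σ_k |ξ_k|^{r_k})^{1-n/r} dξ ≤ c Σ_k ‖D_k^{r_k} f‖₁`. -/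
theorem kolyada_fourier_anisotropic_sobolev (n : ℕ) (hn : 2 ≤ n)
    (r : Fin n → ℕ) (hr : ∀ k, 0 < r k) :
    ∃ c : ℝ, 0 < c ∧
      ∀ (f : EuclideanSpace ℝ (Fin n) → ℝ) (g : Fin n → EuclideanSpace ℝ (Fin n) → ℝ),
        Integrable f volume →
        (∀ k, Integrable (g k) volume) →
        (∀ (k : Fin n) (φ : EuclideanSpace ℝ (Fin n) → ℝ),
          ContDiff ℝ (⊤ : ℕ∞) φ → HasCompactSupport φ →
          ∫ x, f x * ((pderiv k)^[r k] φ) x = (-1 : ℝ) ^ (r k) * ∫ x, g k x * φ x) →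
        (∫⁻ ξ, ENNReal.ofReal (‖fourierTf (fun x => (f x : ℂ)) ξ‖ *
            (∑ k : Fin n, |ξ k| ^ (r k)) ^
              (1 - (n : ℝ) / ((n : ℝ) * (∑ k : Fin n, ((r k : ℝ))⁻¹)⁻¹))))
          ≤ ENNReal.ofReal c * ∑ k : Fin n, eLpNorm (g k) 1 volume := by
  have : Nontrivial (Fin n) := Fin.nontrivial_iff_two_le.2 hn
  choose q hq using fun p : Fin n => exists_ne p
  obtain ⟨e, he⟩ : ∃ e, e = 1 - ∑ k, (r k : ℝ)⁻¹ := ⟨_, rfl⟩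
  have he' : 1 - (n : ℝ) / ((n : ℝ) * (∑ k : Fin n, ((r k : ℝ))⁻¹)⁻¹) = e := by
    have hn0 : (n : ℝ) ≠ 0 := by
      have : n ≠ 0 := by omega
      exact_mod_cast this
    rw [he, ← div_div, div_self hn0, one_div, inv_inv]
  set K : ℝ≥0∞ := ∑ p, regionConst r p (q p) e * 2 with hK
  have hKt : K ≠ ⊤ := ENNReal.sum_ne_top.2 fun p _ =>
    mul_ne_top (regionConst_ne_top hr p (q p) e) ofNat_ne_top
  refine ⟨K.toReal + 1, by positivity, fun f g hf hg hw => ?_⟩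
  rw [he']
  have hKc : K ≤ ENNReal.ofReal (K.toReal + 1) := by
    rw [← ENNReal.ofReal_toReal hKt]
    exact ENNReal.ofReal_le_ofReal (by rw [ENNReal.toReal_ofReal toReal_nonneg]; linarith)
  set G : Fin n → EuclideanSpace ℝ (Fin n) → ℝ := fun k => (hg k).1.mk (g k)
  have hGg : ∀ k, g k =ᵐ[volume] G k := fun k => (hg k).1.ae_eq_mk
  have hGm : ∀ k, Measurable (G k) := fun k => (hg k).1.stronglyMeasurable_mk.measurable
  have hGi : ∀ k, Integrable (G k) := fun k => (hg k).congr (hGg k)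
  have hGw : ∀ k, IsWeakDeriv k (r k) f (G k) := fun k φ hφ hc => by
    rw [hw k φ hφ hc]
    congr 1
    exact integral_congr_ae ((hGg k).mono fun x hx => by simp only [hx])
  have hGn : ∀ k, ∫⁻ x, ‖G k x‖ₑ = eLpNorm (g k) 1 volume := fun k => by
    rw [eLpNorm_congr_ae (hGg k), eLpNorm_one_eq_lintegral_enorm]
  have hle : ∀ k, eLpNorm (g k) 1 volume ≤ ∑ k, eLpNorm (g k) 1 volume := fun k =>
    Finset.single_le_sum (f := fun k => eLpNorm (g k) 1 volume) (fun _ _ => zero_le)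
      (Finset.mem_univ k)
  have hcover : ∀ᵐ ξ : EuclideanSpace ℝ (Fin n),
      ξ ∈ ⋃ p, ⋃ a, ⋃ b, freqBox r p (q p) a b := by
    filter_upwards [ae_all_iff.2 fun k => ae_apply_ne_zero (n := n) k] with ξ hξ
    simpa using exists_mem_freqBox r q hξ
  rw [← setLIntegral_univ, setLIntegral_congr (ae_eq_univ.2 hcover).symm]
  refine (lintegral_iUnion_le _ _).trans ?_
  rw [tsum_fintype]
  calc _ ≤ ∑ p, regionConst r p (q p) e * 2 * ∑ k, eLpNorm (g k) 1 volume := by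
        refine Finset.sum_le_sum fun p _ => ?_
        refine ((lintegral_iUnion_le _ _).trans (ENNReal.tsum_le_tsum fun a =>
          lintegral_iUnion_le _ _)).trans ?_
        refine (tsum_lintegral_freqBox_le hr (hq p) hf (hGm p) (hGi p) (hGm (q p)) (hGi (q p))
          (hGw p) (hGw (q p)) he).trans ?_
        rw [hGn, hGn, mul_assoc, two_mul]
        exact mul_le_mul' le_rfl (add_le_add (hle p) (hle (q p)))
    _ = K * ∑ k, eLpNorm (g k) 1 volume := by rw [hK, Finset.sum_mul]
    _ ≤ _ := mul_le_mul' hKc le_rfl
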